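/- arXiv:1809.10508 — 4 statements merged into one kernel-verified Lean document; each statement's English description precedes it below -/
import Mathlib

section
/- (Distance labeling scheme for cube-free median graphs.) There exist a constant C > 0 and a decoding function D : (List Bool) × (List Bool) → ℕ such that every finite cube-free median graph G on n ≥ 2 vertices admits a labeling ℓ assigning to each vertex v a Boolean string ℓ(v) of length at most C·(log₂ n)³, such that for all vertices u, v of G one has D(ℓ(u), ℓ(v)) = d_G(u,v). -/
open SimpleGraph Set

/-- The metric interval `I(u,v)` in a graph `G`. -/
def gInterval {V : Type*} (G : SimpleGraph V) (u v : V) : Set V :=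
  {w | G.dist u w + G.dist w v = G.dist u v}

/-- A median graph: a connected graph in which every triplet of vertices has a
unique median, i.e. a unique vertex in `I(x,y) ∩ I(y,z) ∩ I(z,x)`. -/
def MedianGraph {V : Type*} (G : SimpleGraph V) : Prop :=
  G.Connected ∧ ∀ x y z : V,
    ∃! m : V, m ∈ gInterval G x y ∧ m ∈ gInterval G y z ∧ m ∈ gInterval G z x

/-- `G` contains an induced `d`-dimensional hypercube all of whose vertices lie in `S`. -/
def HasCubeIn {V : Type*} (G : SimpleGraph V) (d : ℕ) (S : Set V) : Prop :=
  ∃ f : Finset (Fin d) → V, Function.Injective f ∧ (∀ A, f A ∈ S) ∧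
    ∀ A B : Finset (Fin d), G.Adj (f A) (f B) ↔ (symmDiff A B).card = 1

/-- `G` contains an induced `d`-dimensional hypercube `Q_d`. -/
def HasInducedCube {V : Type*} (G : SimpleGraph V) (d : ℕ) : Prop :=
  HasCubeIn G d Set.univ

/-- A cube-free (median) graph: no induced 3-dimensional hypercube. -/
def CubeFree {V : Type*} (G : SimpleGraph V) : Prop :=
  ¬ HasInducedCube G 3

/-- `g` is a gate of `v` in the set `S`. -/
def IsGate {V : Type*} (G : SimpleGraph V) (S : Set V) (v g : V) : Prop :=
  g ∈ S ∧ ∀ u ∈ S, G.dist v u = G.dist v g + G.dist g u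

/-- A set of vertices is gated if every vertex has a gate in it. -/
def Gated {V : Type*} (G : SimpleGraph V) (S : Set V) : Prop :=
  ∀ v : V, ∃ g : V, IsGate G S v g

/-- A set of vertices is convex if it contains the interval between any two of its members. -/
def GConvex {V : Type*} (G : SimpleGraph V) (S : Set V) : Prop :=
  ∀ u ∈ S, ∀ v ∈ S, gInterval G u v ⊆ S

/-- The star `St(z)`: the set of vertices lying in some induced hypercube of `G`
containing `z`. -/
def gStar {V : Type*} (G : SimpleGraph V) (z : V) : Set V :=
  {v | ∃ (d : ℕ) (f : Finset (Fin d) → V), Function.Injective f ∧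
      (∀ A B : Finset (Fin d), G.Adj (f A) (f B) ↔ (symmDiff A B).card = 1) ∧
      (∃ A, f A = z) ∧ (∃ A, f A = v)}

/-- The fiber `F(x)` of `x` with respect to a (gated) set `H`: all vertices having `x`
as their gate in `H`. -/
def fiber {V : Type*} (G : SimpleGraph V) (H : Set V) (x : V) : Set V :=
  {v | IsGate G H v x}

/-- Two fibers are neighboring when an edge of `G` joins them. -/
def Neighboring {V : Type*} (G : SimpleGraph V) (H : Set V) (x y : V) : Prop :=
  ∃ a ∈ fiber G H x, ∃ b ∈ fiber G H y, G.Adj a b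

/-- The boundary `∂_y F(x)`: vertices of `F(x)` having a neighbor in `F(y)`. -/
def bdry {V : Type*} (G : SimpleGraph V) (H : Set V) (x y : V) : Set V :=
  {a | a ∈ fiber G H x ∧ ∃ b ∈ fiber G H y, G.Adj a b}

/-- The total boundary `∂*F(x)`: union of the boundaries `∂_y F(x)` over all `y ∈ H`
adjacent to `x`. -/
def totalBdry {V : Type*} (G : SimpleGraph V) (H : Set V) (x : V) : Set V :=
  ⋃ (y : V) (_ : y ∈ H ∧ G.Adj x y), bdry G H x y

/-- The imprint set of `u` on `A`. -/
def imprints {V : Type*} (G : SimpleGraph V) (u : V) (A : Set V) : Set V :=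
  {a ∈ A | gInterval G u a ∩ A = {a}}

/-- The halfspace `W(u,v)` associated with an edge `uv`. -/
def halfspaceW {V : Type*} (G : SimpleGraph V) (u v : V) : Set V :=
  {z | G.dist z u < G.dist z v}

/-- Metric form of a median graph. -/
structure Med {V : Type} (d : V → V → ℕ) : Prop where
  self : ∀ x, d x x = 0
  eq : ∀ x y, d x y = 0 → x = y
  comm : ∀ x y, d x y = d y x
  tri : ∀ x y z, d x z ≤ d x y + d y z
  step : ∀ x y, x ≠ y → ∃ a, d x a = 1 ∧ d a y + 1 = d x y
  med : ∀ x y z, ∃ m, d x m + d m y = d x y ∧ d y m + d m z = d y z ∧ d x m + d m z = d x z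
  uniq : ∀ x y z m m', d x m + d m y = d x y → d y m + d m z = d y z → d x m + d m z = d x z →
    d x m' + d m' y = d x y → d y m' + d m' z = d y z → d x m' + d m' z = d x z → m = m'

namespace Med

variable {V : Type} {d : V → V → ℕ}

theorem bip (M : Med d) {x y : V} (h : d x y = 1) (z : V) :
    d z x = d z y + 1 ∨ d z y = d z x + 1 := by
  obtain ⟨m, h1, h2, h3⟩ := M.med x y z
  have c1 := M.comm x z
  have c2 := M.comm y z
  have c3 := M.comm x y
  by_cases h0 : d x m = 0
  · have := M.eq _ _ h0
    subst this
    omega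
  · have : d m y = 0 := by omega
    have := M.eq _ _ this
    subst this
    omega

/-- two distinct neighbours of a vertex are at distance 2 -/
theorem two (M : Med d) {s a b : V} (ha : d s a = 1) (hb : d s b = 1) (hab : a ≠ b) :
    d a b = 2 := by
  have t := M.tri a s b
  have c := M.comm a s
  have h0 : d a b ≠ 0 := fun h => hab (M.eq _ _ h)
  have := M.bip hb a
  omega

theorem k23 (M : Med d) {s t a b c : V} (hab : a ≠ b) (hbc : b ≠ c) (hac : a ≠ c)
    (sa : d s a = 1) (sb : d s b = 1) (sc : d s c = 1)
    (ta : d t a = 1) (tb : d t b = 1) (tc : d t c = 1) : s = t := by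
  have h1 := M.two sa sb hab
  have h2 := M.two sb sc hbc
  have h3 := M.two sa sc hac
  have c1 := M.comm a s
  have c2 := M.comm b s
  have c4 := M.comm a t
  have c5 := M.comm b t
  apply M.uniq a b c s t <;> omega

theorem star (M : Med d) {x y w m : V} (hw : d w x < d w y) (hm : d w m + d m x = d w x) :
    d m x < d m y := by
  have := M.tri w m y
  omega

theorem convex_end (M : Med d) {x y u w u1 : V} (hxy : d x y = 1) (hD : d u w = 2)
    (hu1 : d u u1 = 1) (g1 : d u1 w = 1) (g2 : d w x = d u x) (g3 : d u1 y = d u x)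
    (g4 : d u y = d u x + 1) (g5 : d w y = d u x + 1) (g6 : ¬ d u1 x < d u1 y) : False := by
  have hu : d u x < d u y := by omega
  obtain ⟨m, m1, m2, m3⟩ := M.med u w x
  have hm : d m x < d m y := M.star hu m3
  have b5 := M.bip hxy m
  have c8 := M.comm u m
  have c9 := M.comm w m
  have k1 : d m u = 1 := by omega
  have k2 : d m w = 1 := by omega
  have hu1m : d u1 m ≠ 0 := by
    intro h
    have := M.eq _ _ h
    subst this
    exact g6 hm
  have hum : u1 ≠ m := by
    rintro rfl
    exact hu1m (M.self _)
  have k3 : d u1 m = 2 := M.two (s := u) hu1 (by omega) hum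
  obtain ⟨s, s1, s2, s3⟩ := M.med u1 m y
  have c10 := M.comm m s
  have c11 := M.comm u u1
  have hmy : d m y = d u x := by omega
  have hs1 : d u1 s = 1 := by omega
  have hs2 : d m s = 1 := by omega
  have hs3 : d s y < d u y := by omega
  have hs4 : d s y < d w y := by omega
  apply hum
  apply M.k23 (a := u) (b := w) (c := s)
  · rintro rfl
    have := M.self u
    omega
  · rintro rfl
    exact absurd hs4 (lt_irrefl _)
  · rintro rfl
    exact absurd hs3 (lt_irrefl _)
  all_goals omega

theorem convex_aux (M : Med d) {x y : V} (hxy : d x y = 1) : ∀ (n : ℕ) (u w z : V), d u w = n →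
    d u x < d u y → d w x < d w y → d u z + d z w = d u w → d z x < d z y := by
  intro n
  induction n using Nat.strong_induction_on with
  | _ n ih =>
  intro u w z hn hu hw hz
  by_contra hzn
  have bz := M.bip hxy z
  have huz : u ≠ z := by rintro rfl; omega
  obtain ⟨u1, hu1, hu1z⟩ := M.step u z huz
  have t1 := M.tri u1 z w
  have t2 := M.tri u u1 w
  have e1 : d u w = 1 + d u1 w := by omega
  have hu1y : ¬ d u1 x < d u1 y := by
    intro hc
    exact hzn (ih (d u1 w) (by omega) u1 w z rfl hc hw (by omega))
  have hwu1 : w ≠ u1 := by rintro rfl; omega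
  obtain ⟨w1, hw1, hw1u⟩ := M.step w u1 hwu1
  have c1 := M.comm w u1
  have c2 := M.comm w w1
  have c3 := M.comm w1 u1
  have t3 := M.tri u u1 w1
  have t4 := M.tri u w1 w
  have e2 : d u w = d u w1 + 1 := by omega
  have hw1y : ¬ d w1 x < d w1 y := by
    intro hc
    exact hu1y (ih (d u w1) (by omega) u w1 u1 rfl hu hc (by omega))
  -- medians
  have f1 : d u1 x = d u1 w + d w x := by
    obtain ⟨m, m1, m2, m3⟩ := M.med u1 w x
    have hm : d m x < d m y := M.star hw m2
    have t5 := M.tri u m w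
    have t6 := M.tri u u1 m
    by_cases h0 : d m w = 0
    · have := M.eq _ _ h0
      subst this
      omega
    · exact absurd (ih (d u m) (by omega) u m u1 rfl hu hm (by omega)) hu1y
  have f2 : d w1 x = d w1 u + d u x := by
    obtain ⟨m, m1, m2, m3⟩ := M.med w1 u x
    have hm : d m x < d m y := M.star hu m2
    have t5 := M.tri u m w
    have t6 := M.tri m w1 w
    have c4 := M.comm w1 m
    have c5 := M.comm u m
    have c6 := M.comm u w1
    by_cases h0 : d m u = 0
    · have := M.eq _ _ h0
      subst this
      omega
    · exact absurd (ih (d m w) (by omega) m w w1 rfl hm hw (by omega)) hw1y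
  have c6 := M.comm u w1
  have b1 := M.bip hxy u
  have b2 := M.bip hxy u1
  have b3 := M.bip hxy w
  have b4 := M.bip hxy w1
  have t7 := M.tri u1 u x
  have t8 := M.tri u u1 y
  have t9 := M.tri w1 w x
  have t10 := M.tri w w1 y
  have c7 := M.comm u u1
  have t11 := M.tri u u1 x
  have t12 := M.tri w w1 x
  have hD : d u w = 2 := by omega
  have g1 : d u1 w = 1 := by omega
  have g2 : d w x = d u x := by omega
  have g3 : d u1 y = d u x := by omega
  have g4 : d u y = d u x + 1 := by omega
  have g5 : d w y = d u x + 1 := by omega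
  exact M.convex_end hxy hD hu1 g1 g2 g3 g4 g5 hu1y

theorem convex (M : Med d) {x y : V} (hxy : d x y = 1) {u w z : V}
    (hu : d u x < d u y) (hw : d w x < d w y) (hz : d u z + d z w = d u w) : d z x < d z y :=
  M.convex_aux hxy _ u w z rfl hu hw hz

/-- Metric form of a 3-cube. -/
def CubeD (d : V → V → ℕ) : Prop :=
  ∃ z b1 b2 b3 c12 c13 c23 e : V,
    b1 ≠ b2 ∧ b1 ≠ b3 ∧ b2 ≠ b3 ∧ c12 ≠ c13 ∧ c12 ≠ c23 ∧ c13 ≠ c23 ∧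
    d z b1 = 1 ∧ d z b2 = 1 ∧ d z b3 = 1 ∧ d e c12 = 1 ∧ d e c13 = 1 ∧ d e c23 = 1 ∧
    d b1 c12 = 1 ∧ d b2 c12 = 1 ∧ d b3 c12 ≠ 1 ∧
    d b1 c13 = 1 ∧ d b2 c13 ≠ 1 ∧ d b3 c13 = 1 ∧
    d b1 c23 ≠ 1 ∧ d b2 c23 = 1 ∧ d b3 c23 = 1 ∧
    ∃ x k, d x z = k + 3 ∧ d x b1 = k + 2 ∧ d x b2 = k + 2 ∧ d x b3 = k + 2 ∧
      d x c12 = k + 1 ∧ d x c13 = k + 1 ∧ d x c23 = k + 1 ∧ d x e = k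

theorem low (M : Med d) {x z b1 b2 : V} (h1 : d z b1 = 1) (h2 : d z b2 = 1) (hne : b1 ≠ b2)
    (e1 : d x b1 + 1 = d x z) (e2 : d x b2 + 1 = d x z) :
    ∃ c, d b1 c = 1 ∧ d b2 c = 1 ∧ d x c + 2 = d x z := by
  have h := M.two h1 h2 hne
  obtain ⟨c, m1, m2, m3⟩ := M.med b1 b2 x
  have := M.comm c b2
  have := M.comm b1 x
  have := M.comm b2 x
  have := M.comm c x
  exact ⟨c, by omega, by omega, by omega⟩

theorem cube (M : Med d) {x z b1 b2 b3 : V} (h1 : d z b1 = 1) (h2 : d z b2 = 1) (h3 : d z b3 = 1)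
    (n12 : b1 ≠ b2) (n13 : b1 ≠ b3) (n23 : b2 ≠ b3)
    (e1 : d x b1 + 1 = d x z) (e2 : d x b2 + 1 = d x z) (e3 : d x b3 + 1 = d x z) : CubeD d := by
  obtain ⟨c12, p1, p2, p3⟩ := M.low h1 h2 n12 e1 e2
  obtain ⟨c13, q1, q2, q3⟩ := M.low h1 h3 n13 e1 e3
  obtain ⟨c23, r1, r2, r3⟩ := M.low h2 h3 n23 e2 e3
  have key : ∀ c, d x c + 2 = d x z → d b1 c = 1 → d b2 c = 1 → d b3 c = 1 → False := by
    intro c hc a1 a2 a3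
    have : z = c := M.k23 n12 n23 n13 h1 h2 h3 (by rw [M.comm]; exact a1)
      (by rw [M.comm]; exact a2) (by rw [M.comm]; exact a3)
    subst this
    omega
  have m12 : c12 ≠ c13 := by rintro rfl; exact key _ p3 p1 p2 q2
  have m13 : c12 ≠ c23 := by rintro rfl; exact key _ p3 p1 p2 r2
  have m23 : c13 ≠ c23 := by rintro rfl; exact key _ q3 q1 r1 q2
  have u1 := M.two p1 q1 m12
  have u2 := M.two p2 r1 m13
  have u3 := M.two q2 r2 m23
  obtain ⟨e, f1, f2, f3⟩ := M.med c12 c13 c23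
  have w1 := M.comm c12 e
  have w2 := M.comm c13 e
  have w3 := M.comm c23 e
  have g1 : d e c12 = 1 := by omega
  have g2 : d e c13 = 1 := by omega
  have g3 : d e c23 = 1 := by omega
  have he : d x e + 3 = d x z := by
    rcases M.bip g1 x with h | h
    · exfalso
      have hp : d c12 b1 = 1 := by rw [M.comm]; exact p1
      have hq : d c13 b1 = 1 := by rw [M.comm]; exact q1
      have nb : e ≠ b1 := by
        rintro rfl
        exact key _ r3 g3 r1 r2
      obtain ⟨a, a1, a2, a3⟩ := M.med c12 c13 x
      have := M.comm c12 x
      have := M.comm c13 x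
      have := M.comm a x
      have := M.comm c13 a
      exact m12 (M.k23 (a := b1) (b := e) (c := a) nb.symm (by rintro rfl; omega)
        (by rintro rfl; omega) hp (by omega) (by omega) hq (by omega) (by omega))
    · omega
  refine ⟨z, b1, b2, b3, c12, c13, c23, e, n12, n13, n23, m12, m13, m23, h1, h2, h3, g1, g2, g3,
    p1, p2, fun h => key _ p3 p1 p2 h, q1, fun h => key _ q3 q1 h q2, q2,
    fun h => key _ r3 h r1 r2, r1, r2, x, d x e, ?_⟩
  omega

/-- The interval `I(x,w)` is a chain. -/
def Chain (d : V → V → ℕ) (x w : V) : Prop :=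
  ∀ a b, d x a + d a w = d x w → d x b + d b w = d x w →
    d x a + d a b = d x b ∨ d x b + d b a = d x a

theorem le_trans (M : Med d) {x a b c : V} (h1 : d x a + d a b = d x b)
    (h2 : d x b + d b c = d x c) : d x a + d a c = d x c := by
  have := M.tri x a c
  have := M.tri a b c
  omega

/-- the halfspace of the last edge of a chain is its up-set -/
theorem not_mem_half (M : Med d) {x g p z : V} (hc : Chain d x g) (hgp : d g p = 1)
    (hp : d x p + 1 = d x g) (hz : ¬ d x g + d g z = d x z) : d z p < d z g := by
  by_contra hcon
  have b := M.bip hgp z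
  obtain ⟨t, t1, t2, t3⟩ := M.med x z g
  have hgg : d g g < d g p := by rw [M.self]; omega
  have ht : d t g < d t p := M.convex hgp (u := z) (w := g) (by omega) hgg t2
  have c1 := M.comm g p
  rcases hc t p t3 (by omega) with h | h
  · omega
  · have : d t g = 0 := by
      have := M.comm p t
      have := M.tri x p t
      omega
    have := M.eq _ _ this
    subst this
    exact hz t1

theorem antichain (M : Med d) (hQ : ¬ CubeD d) {x v g1 g2 g3 : V}
    (c1 : Chain d x g1) (c2 : Chain d x g2) (c3 : Chain d x g3)
    (v1 : d x g1 + d g1 v = d x v) (v2 : d x g2 + d g2 v = d x v) (v3 : d x g3 + d g3 v = d x v)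
    (n12 : ¬ d x g1 + d g1 g2 = d x g2) (n21 : ¬ d x g2 + d g2 g1 = d x g1)
    (n13 : ¬ d x g1 + d g1 g3 = d x g3) (n31 : ¬ d x g3 + d g3 g1 = d x g1)
    (n23 : ¬ d x g2 + d g2 g3 = d x g3) (n32 : ¬ d x g3 + d g3 g2 = d x g2) : False := by
  have hex : ∃ n, ∃ z, d x z = n ∧ d x g1 + d g1 z = d x z ∧ d x g2 + d g2 z = d x z ∧
      d x g3 + d g3 z = d x z := ⟨_, v, rfl, v1, v2, v3⟩
  classical
  obtain ⟨z, hz, z1, z2, z3⟩ := Nat.find_spec hex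
  have hmin : ∀ b, d x b < d x z → d x g1 + d g1 b = d x b → d x g2 + d g2 b = d x b →
      d x g3 + d g3 b = d x b → False := by
    intro b hb h1 h2 h3
    exact Nat.find_min hex (by rw [← hz]; exact hb) ⟨b, rfl, h1, h2, h3⟩
  have main : ∀ g1 g2 g3 : V, Chain d x g3 → d x g1 + d g1 z = d x z → d x g2 + d g2 z = d x z →
      d x g3 + d g3 z = d x z → ¬ d x g3 + d g3 g1 = d x g1 → ¬ d x g3 + d g3 g2 = d x g2 →
      ∃ b, d z b = 1 ∧ d x b + 1 = d x z ∧ d x g1 + d g1 b = d x b ∧ d x g2 + d g2 b = d x b := by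
    intro g1 g2 g3 c3 z1 z2 z3 n31 n32
    obtain ⟨j, j1, j2, j3⟩ := M.med g1 g2 z
    have hx3 : g3 ≠ x := by
      rintro rfl
      apply n31
      rw [M.self]; omega
    obtain ⟨p, p1, p2⟩ := M.step g3 x hx3
    have hp : d x p + 1 = d x g3 := by
      rw [M.comm x p, M.comm x g3]; exact p2
    have hj : d j p < d j g3 := by
      have e1 := M.not_mem_half c3 p1 hp n31
      have e2 := M.not_mem_half c3 p1 hp n32
      exact M.convex (by rw [M.comm]; exact p1) e1 e2 j1
    have hjz : z ≠ j := by
      rintro rfl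
      have := M.tri x p z
      have := M.comm p z
      have := M.comm z g3
      omega
    obtain ⟨b, b1, b2⟩ := M.step z j hjz
    have e1 := M.comm z j
    have e2 := M.comm b j
    have e3 := M.comm z b
    have t1 := M.tri x g1 j
    have t2 := M.tri x g2 j
    have t3 := M.tri x j z
    have t4 := M.tri x j b
    have t5 := M.tri x b z
    have hj1 : d x g1 + d g1 j = d x j := by omega
    have hj2 : d x g2 + d g2 j = d x j := by omega
    have hjb : d x j + d j b = d x b := by omega
    exact ⟨b, b1, by omega, M.le_trans hj1 hjb, M.le_trans hj2 hjb⟩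
  obtain ⟨b3, p1, p2, p3, p4⟩ := main g1 g2 g3 c3 z1 z2 z3 n31 n32
  obtain ⟨b2, q1, q2, q3, q4⟩ := main g1 g3 g2 c2 z1 z3 z2 n21 n23
  obtain ⟨b1, r1, r2, r3, r4⟩ := main g2 g3 g1 c1 z2 z3 z1 n12 n13
  apply hQ
  refine M.cube (x := x) r1 q1 p1 ?_ ?_ ?_ r2 q2 p2
  · rintro rfl; exact hmin b1 (by omega) q3 r3 r4
  · rintro rfl; exact hmin b1 (by omega) p3 r3 r4
  · rintro rfl; exact hmin b2 (by omega) q3 p4 q4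

set_option maxHeartbeats 1000000 in
/-- the median of two vertices in different cells is on the tree -/
theorem chain_med (M : Med d) (hQ : ¬ CubeD d) {c x y u v m : V} (hx : d c x = 1) (hy : d c y = 1)
    (hxy : x ≠ y) (hux : d u x < d u c) (huy : d u y < d u c)
    (hvy : ¬ d v y < d v c) (m1 : d x m + d m u = d x u) (m2 : d x m + d m v = d x v) :
    Chain d x m := by
  intro w1 w2 hw1 hw2
  by_contra hcon
  push Not at hcon
  obtain ⟨hc1, hc2⟩ := hcon
  have xy2 := M.two hx hy hxy
  have hyc : d y c = 1 := by rw [M.comm]; exact hy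
  have cxc := M.comm x c
  have hxH : d x c < d x y := by omega
  have bv := M.bip hy v
  have bu := M.bip hy u
  have bu' := M.bip hx u
  have hvH : d v c < d v y := by omega
  have inH : ∀ w, d x w + d w m = d x m → d w c < d w y := fun w hw =>
    M.convex hy hxH hvH (M.le_trans hw m2)
  obtain ⟨q0, q1, q2, q3⟩ := M.med x y u
  have cxu := M.comm x u
  have cyu := M.comm y u
  have cyq := M.comm q0 y
  have hq0 : d x q0 = 1 := by omega
  have hyy : d y y < d y c := by rw [M.self]; omega
  have hq0H : d q0 y < d q0 c := M.convex hyc hyy huy q2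
  obtain ⟨p, p1, p2, p3⟩ := M.med x w1 w2
  have hp1 : p ≠ w1 := by rintro rfl; omega
  have hp2 : p ≠ w2 := by
    rintro rfl
    have := M.comm w1 p
    have := M.comm p w1
    omega
  obtain ⟨a1, a11, a12⟩ := M.step p w1 hp1
  obtain ⟨a2, a21, a22⟩ := M.step p w2 hp2
  have ltr : ∀ {a b e : V}, d x a + d a b = d x b → d a e + d e b = d a b →
      d x e + d e b = d x b ∧ d x a + d a e = d x e := by
    intro a b e h1 h2
    have := M.tri x a e
    have := M.tri x e b
    omega
  have hpm : d x p + d p m = d x m := M.le_trans p1 hw1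
  have ha1 : d x a1 + d a1 m = d x m := M.le_trans (ltr p1 (by omega)).1 hw1
  have ha2 : d x a2 + d a2 m = d x m := M.le_trans (ltr p3 (by omega)).1 hw2
  have s1 := (ltr p1 (show d p a1 + d a1 w1 = d p w1 by omega)).2
  have s2 := (ltr p3 (show d p a2 + d a2 w2 = d p w2 by omega)).2
  have h12 : a1 ≠ a2 := by
    rintro rfl
    have := M.tri w1 a1 w2
    have := M.comm w1 a1
    have := M.comm w1 p
    omega
  obtain ⟨q, r1, r2, r3⟩ := M.med q0 p u
  have hqH : d q y < d q c := M.convex hyc hq0H huy r3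
  have hpu := M.le_trans hpm m1
  have hxq := (ltr hpu r2).2
  have bq := M.bip hq0 q
  have bp := M.bip hq0 p
  have hpH := inH p hpm
  have A1 : d p q0 = d p x + 1 := by
    rcases bp with h | h
    · exfalso
      have := M.convex hy hpH hxH (z := q0) (by have := M.comm x q0; omega)
      omega
    · exact h
  have A2 : d q q0 + 1 = d q x := by
    rcases bq with h | h
    · omega
    · exfalso
      have := M.convex hyc hqH hq0H (z := x) (by omega)
      omega
  have e1 := M.comm q x
  have e2 := M.comm p x
  have e3 := M.comm q q0
  have e4 := M.comm q p
  have e5 := M.comm p q0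
  have hpq : d p q = 1 := by omega
  have z1 := M.le_trans ha1 m1
  have z2 := M.le_trans ha2 m1
  have f1 := M.comm u p
  have f2 := M.comm u a1
  have f3 := M.comm u a2
  have f4 := M.comm u q
  apply hQ
  refine M.cube (x := u) a11 a21 hpq h12 ?_ ?_ (by omega) (by omega) (by omega)
  · rintro rfl
    have := inH _ ha1
    omega
  · rintro rfl
    have := inH _ ha2
    omega

end Med

/-! ### Tree labels -/

/-- Decoder for tree labels. -/
def tdec : List (ℕ × ℕ) → List (ℕ × ℕ) → ℕ
  | (i, b) :: l, (i', b') :: l' =>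
    if i = i' then (if b = b' ∧ b ≠ 0 then tdec l l' else i) else min i i'
  | _, _ => 0

theorem heavy {V : Type} (n : ℕ) (Mf : V → V → ℕ) (hMn : ∀ a b, Mf a b ≤ n)
    (T : Set V) (hsymm : ∀ a ∈ T, ∀ b ∈ T, Mf a b = Mf b a)
    (hult : ∀ a ∈ T, ∀ b ∈ T, ∀ c ∈ T, min (Mf a b) (Mf b c) ≤ Mf a c)
    (S : Finset V) (hST : ∀ a ∈ S, a ∈ T) (hne : S.Nonempty) :
    ∃ s ∈ S, ∀ h ∈ S, 2 * (S.filter (fun h' => Mf s h + 1 ≤ Mf h h')).card ≤ S.card := by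
  classical
  let P : ℕ → Prop := fun t => ∃ s ∈ S, S.card < 2 * (S.filter (fun h' => t ≤ Mf s h')).card
  have hP0 : P 0 := by
    obtain ⟨s, hs⟩ := hne
    refine ⟨s, hs, ?_⟩
    have : S.filter (fun h' => 0 ≤ Mf s h') = S := by simp
    rw [this]
    have := Finset.card_pos.mpr ⟨s, hs⟩
    omega
  have hspec : P (Nat.findGreatest P n) := Nat.findGreatest_spec (Nat.zero_le n) hP0
  have hgr : ∀ t, Nat.findGreatest P n < t → ¬ P t := by
    intro t ht
    by_cases htn : t ≤ n
    · exact Nat.findGreatest_is_greatest ht htn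
    · rintro ⟨s, _, hs⟩
      have : S.filter (fun h' => t ≤ Mf s h') = ∅ := by
        apply Finset.filter_eq_empty_iff.mpr
        intro a _ h
        have := hMn s a
        omega
      rw [this] at hs
      simp at hs
  generalize Nat.findGreatest P n = t at hspec hgr
  obtain ⟨s, hs, hcard⟩ := hspec
  refine ⟨s, hs, fun h hh => ?_⟩
  by_cases hi : t ≤ Mf s h
  · by_contra hc
    exact hgr (Mf s h + 1) (by omega) ⟨h, hh, by omega⟩
  · have hdis : Disjoint (S.filter (fun h' => Mf s h + 1 ≤ Mf h h'))
        (S.filter (fun h' => t ≤ Mf s h')) := by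
      rw [Finset.disjoint_left]
      intro a ha hb
      rw [Finset.mem_filter] at ha hb
      have h1 := hult s (hST s hs) a (hST a ha.1) h (hST h hh)
      have h2 := hsymm a (hST a ha.1) h (hST h hh)
      omega
    have h1 := Finset.card_union_of_disjoint hdis
    have h2 := Finset.card_le_card (Finset.union_subset
      (Finset.filter_subset (fun h' => Mf s h + 1 ≤ Mf h h') S)
      (Finset.filter_subset (fun h' => t ≤ Mf s h') S))
    omega

theorem tree_label {V : Type} (n : ℕ) (idx : V → ℕ) (hinj : Function.Injective idx)
    (hidx : ∀ v, idx v < n) (Mf : V → V → ℕ) (hMn : ∀ a b, Mf a b ≤ n)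
    (T : Set V) (hsymm : ∀ a ∈ T, ∀ b ∈ T, Mf a b = Mf b a)
    (hult : ∀ a ∈ T, ∀ b ∈ T, ∀ c ∈ T, min (Mf a b) (Mf b c) ≤ Mf a c) :
    ∀ (k : ℕ) (S : Finset V), (∀ a ∈ S, a ∈ T) → S.card < 2 ^ k →
      ∃ lam : V → List (ℕ × ℕ),
        (∀ u ∈ S, (lam u).length ≤ k ∧ ∀ p ∈ lam u, p.1 ≤ n ∧ p.2 ≤ n) ∧
        ∀ u ∈ S, ∀ v ∈ S, tdec (lam u) (lam v) = Mf u v := by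
  classical
  intro k
  induction k with
  | zero =>
    intro S _ hS
    have : S = ∅ := Finset.card_eq_zero.mp (by simpa using hS)
    subst this
    exact ⟨fun _ => [], by simp, by simp⟩
  | succ k ih =>
    intro S hST hS
    rcases S.eq_empty_or_nonempty with rfl | hne
    · exact ⟨fun _ => [], by simp, by simp⟩
    choose! F hF1 hF2 using ih
    obtain ⟨s, hs, hheavy⟩ := heavy n Mf hMn T hsymm hult S hST hne
    let K : V → Finset V := fun h => S.filter (fun h' => Mf s h + 1 ≤ Mf h h')
    have hK : ∀ h w, w ∈ K h ↔ w ∈ S ∧ Mf s h + 1 ≤ Mf h w := fun h w => Finset.mem_filter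
    have hKT : ∀ h, ∀ a ∈ K h, a ∈ T := fun h a ha => hST a ((hK h a).1 ha).1
    have hKc : ∀ h ∈ S, (K h).card < 2 ^ k := by
      intro h hh
      have h1 : 2 * (K h).card ≤ S.card := hheavy h hh
      rw [pow_succ] at hS
      omega
    let cid : V → ℕ := fun h => if K h = ∅ then 0 else sInf (idx '' (K h : Set V)) + 1
    have hcid : ∀ h, (K h = ∅ ∧ cid h = 0) ∨ ∃ w ∈ K h, cid h = idx w + 1 := by
      intro h
      by_cases hh : K h = ∅
      · left; exact ⟨hh, by simp [cid, hh]⟩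
      · right
        have hne : (idx '' (K h : Set V)).Nonempty := by
          simpa using Finset.nonempty_iff_ne_empty.mpr hh
        obtain ⟨w, hw, hw'⟩ := Nat.sInf_mem hne
        exact ⟨w, by simpa using hw, by simp [cid, hh, hw']⟩
    have hKeq : ∀ u ∈ S, ∀ v ∈ S, Mf s u = Mf s v → Mf s u + 1 ≤ Mf u v → K u = K v := by
      intro u hu v hv h1 h2
      ext w
      rw [hK, hK]
      refine and_congr_right fun hw => ?_
      have a1 := hult u (hST u hu) v (hST v hv) w (hST w hw)
      have a2 := hult v (hST v hv) u (hST u hu) w (hST w hw)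
      have a3 := hsymm u (hST u hu) v (hST v hv)
      omega
    refine ⟨fun h => (Mf s h, cid h) :: if K h = ∅ then [] else F (K h) h, ?_, ?_⟩
    · intro u hu
      have huK : u ∈ K u ∨ K u = ∅ := by
        by_cases h : K u = ∅
        · exact Or.inr h
        · left
          obtain ⟨w, hw⟩ := Finset.nonempty_iff_ne_empty.mpr h
          rw [hK] at hw ⊢
          refine ⟨hu, ?_⟩
          have a1 := hult u (hST u hu) w (hST w hw.1) u (hST u hu)
          have a3 := hsymm u (hST u hu) w (hST w hw.1)
          omega
      have hcn : cid u ≤ n := by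
        rcases hcid u with ⟨_, h0⟩ | ⟨w, _, hw⟩
        · omega
        · have := hidx w
          omega
      have htail : (if K u = ∅ then [] else F (K u) u).length ≤ k ∧
          ∀ p ∈ (if K u = ∅ then [] else F (K u) u), p.1 ≤ n ∧ p.2 ≤ n := by
        rcases huK with h | h
        · rw [if_neg (Finset.ne_empty_of_mem h)]
          exact hF1 (K u) (hKT u) (hKc u hu) u h
        · rw [if_pos h]
          simp
      simp only [List.length_cons, List.mem_cons]
      refine ⟨by omega, ?_⟩
      rintro p (rfl | hp)
      · exact ⟨hMn _ _, hcn⟩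
      · exact htail.2 p hp
    · intro u hu v hv
      have su := hST u hu
      have sv := hST v hv
      have ss := hST s hs
      have a1 := hult u su s ss v sv
      have a2 := hult s ss u su v sv
      have a3 := hult s ss v sv u su
      have b1 := hsymm u su v sv
      have b2 := hsymm u su s ss
      simp only [tdec]
      by_cases h1 : Mf s u = Mf s v
      swap
      · rw [if_neg h1]
        omega
      rw [if_pos h1]
      by_cases h2 : cid u = cid v ∧ cid u ≠ 0
      · rw [if_pos h2]
        obtain ⟨h2, h3⟩ := h2
        rcases hcid u with ⟨_, hu0⟩ | ⟨w, hw, hwu⟩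
        · exact absurd hu0 h3
        rcases hcid v with ⟨_, hv0⟩ | ⟨w', hw', hwv⟩
        · omega
        have : w = w' := hinj (by omega)
        subst this
        rw [hK] at hw hw'
        have c1 := hult u su w (hST w hw.1) v sv
        have c2 := hsymm w (hST w hw.1) v sv
        have c3 := hult u su v sv u su
        have hKK := hKeq u hu v hv h1 (by omega)
        have hne' : K u ≠ ∅ := Finset.ne_empty_of_mem ((hK u u).2 ⟨hu, by omega⟩)
        rw [← hKK, if_neg hne', if_neg hne']
        exact hF2 (K u) (hKT u) (hKc u hu) u ((hK u u).2 ⟨hu, by omega⟩) v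
          ((hK u v).2 ⟨hv, by omega⟩)
      · rw [if_neg h2]
        by_contra hc
        have hKK := hKeq u hu v hv h1 (by omega)
        have hvK : v ∈ K u := (hK u v).2 ⟨hv, by omega⟩
        apply h2
        refine ⟨by simp only [cid, hKK], ?_⟩
        have : K u ≠ ∅ := Finset.ne_empty_of_mem hvK
        simp [cid, this]

/-! ### Main recursion -/

/-- An entry: neighbour id, distance, and two tree labels. -/
abbrev Ent := ℕ × ℕ × List (ℕ × ℕ) × List (ℕ × ℕ)

/-- A level of a label. -/
abbrev Lev := ℕ × Ent × Ent

/-- Distance decoded from two entries with the same neighbour id. -/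
def ed (e f : Ent) : ℕ :=
  e.2.1 + f.2.1 - 2 * max (max (tdec e.2.2.1 f.2.2.1) (tdec e.2.2.1 f.2.2.2))
    (max (tdec e.2.2.2 f.2.2.1) (tdec e.2.2.2 f.2.2.2))

/-- The decoder on structured labels. -/
def ldec : List Lev → List Lev → ℕ
  | (a, e1, e2) :: l, (b, f1, f2) :: l' =>
    if (e1.1 = f1.1 ∧ e2.1 = f2.1) ∨ (e1.1 = f2.1 ∧ e2.1 = f1.1) then ldec l l'
    else if e1.1 = f1.1 then ed e1 f1
    else if e1.1 = f2.1 then ed e1 f2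
    else if e2.1 = f1.1 then ed e2 f1
    else if e2.1 = f2.1 then ed e2 f2
    else a + b
  | _, _ => 0

theorem centroid {V : Type} [Fintype V] [Nonempty V] {d : V → V → ℕ} (M : Med d) (S : Finset V) :
    ∃ c, ∀ x, d c x = 1 → 2 * (S.filter (fun v => d v x < d v c)).card ≤ S.card := by
  classical
  obtain ⟨c, -, hc⟩ := Finset.exists_min_image (Finset.univ : Finset V)
    (fun c => ∑ v ∈ S, d v c) Finset.univ_nonempty
  refine ⟨c, fun x hx => ?_⟩
  have h1 := hc x (Finset.mem_univ x)
  have h2 : ∑ v ∈ S, (d v x + 2 * (if d v x < d v c then 1 else 0)) = ∑ v ∈ S, (d v c + 1) := by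
    apply Finset.sum_congr rfl
    intro v _
    have := M.bip hx v
    split_ifs <;> omega
  rw [Finset.sum_add_distrib, Finset.sum_add_distrib, ← Finset.mul_sum, ← Finset.card_filter] at h2
  simp only [Finset.sum_const, smul_eq_mul, mul_one] at h2
  omega

theorem two_nbrs {V : Type} {d : V → V → ℕ} (M : Med d) (hQ : ¬ Med.CubeD d) (c v : V)
    (hv : v ≠ c) : ∃ x y, d c x = 1 ∧ d c y = 1 ∧ d v x < d v c ∧ d v y < d v c ∧
      ∀ z, d c z = 1 → d v z < d v c → z = x ∨ z = y := by
  obtain ⟨x, hx, hx'⟩ := M.step c v hv.symm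
  have c1 := M.comm x v
  have c2 := M.comm c v
  by_cases h : ∃ y, d c y = 1 ∧ d v y < d v c ∧ y ≠ x
  · obtain ⟨y, y1, y2, y3⟩ := h
    refine ⟨x, y, hx, y1, by omega, y2, fun z z1 z2 => ?_⟩
    by_contra hc
    push Not at hc
    have bx := M.bip y1 v
    have bz := M.bip z1 v
    exact hQ (M.cube (x := v) hx y1 z1 y3.symm hc.1.symm hc.2.symm (by omega) (by omega) (by omega))
  · push Not at h
    exact ⟨x, x, hx, hx, by omega, by omega, fun z z1 z2 => Or.inl (h z z1 z2)⟩

theorem main_rec {V : Type} [Fintype V] [Nonempty V] {d : V → V → ℕ} (M : Med d)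
    (hQ : ¬ Med.CubeD d) (idx : V → ℕ) (hinj : Function.Injective idx)
    (ent : V → V → Ent) (hid : ∀ x v, (ent x v).1 = idx x + 1)
    (hent : ∀ x u v m, d x m + d m u = d x u → d u m + d m v = d u v → d x m + d m v = d x v →
      Med.Chain d x m → ed (ent x u) (ent x v) = d u v)
    (P : Lev → Prop) (hP0 : P (0, (0, 0, [], []), (0, 0, [], [])))
    (hP : ∀ c x y v, P (d c v, ent x v, ent y v)) :
    ∀ (k : ℕ) (S : Finset V), S.card < 2 ^ k →
      ∃ lab : V → List Lev, (∀ u ∈ S, (lab u).length ≤ k ∧ ∀ p ∈ lab u, P p) ∧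
        ∀ u ∈ S, ∀ v ∈ S, ldec (lab u) (lab v) = d u v := by
  classical
  intro k
  induction k with
  | zero =>
    intro S hS
    have : S = ∅ := Finset.card_eq_zero.mp (by simpa using hS)
    subst this
    exact ⟨fun _ => [], by simp, by simp⟩
  | succ k ih =>
    intro S hS
    choose! F hF1 hF2 using ih
    obtain ⟨c, hc⟩ := centroid M S
    have h2 := two_nbrs M hQ c
    choose! X Y hX hY hvX hvY hXY using h2
    let K : V → Finset V := fun v => S.filter (fun w => w ≠ c ∧ s(X w, Y w) = s(X v, Y v))
    have hK : ∀ v w, w ∈ K v ↔ w ∈ S ∧ w ≠ c ∧ s(X w, Y w) = s(X v, Y v) :=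
      fun v w => Finset.mem_filter
    have hKc : ∀ v, v ≠ c → (K v).card < 2 ^ k := by
      intro v hv
      have h1 : K v ⊆ S.filter (fun w => d w (X v) < d w c) := by
        intro w hw
        rw [hK] at hw
        rw [Finset.mem_filter]
        refine ⟨hw.1, ?_⟩
        rcases Sym2.eq_iff.mp hw.2.2 with h | h
        · rw [← h.1]; exact hvX w hw.2.1
        · rw [← h.2]; exact hvY w hw.2.1
      have h3 := Finset.card_le_card h1
      have h4 := hc (X v) (hX v hv)
      rw [pow_succ] at hS
      omega
    -- distance through a common neighbour
    have hcom : ∀ u v x y, d c x = 1 → d c y = 1 → x ≠ y → d u x < d u c → d u y < d u c →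
        ¬ d v y < d v c → ed (ent x u) (ent x v) = d u v ∧ ed (ent x v) (ent x u) = d u v := by
      intro u v x y hx hy hxy hu hu' hv
      obtain ⟨m, m1, m2, m3⟩ := M.med x u v
      have hch := M.chain_med hQ hx hy hxy hu hu' hv m1 m3
      refine ⟨hent x u v m m1 m2 m3 hch, ?_⟩
      rw [M.comm u v]
      refine hent x v u m m3 ?_ m1 hch
      rw [M.comm v m, M.comm m u, M.comm v u]
      omega
    have hcom2 : ∀ u v x, u ≠ c → v ≠ c → d c x = 1 → d u x < d u c → d v x < d v c →
        s(X u, Y u) ≠ s(X v, Y v) → ed (ent x u) (ent x v) = d u v := by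
      intro u v x hu hv hx hux hvx hne
      -- find a neighbour in one but not in the other
      by_cases h1 : ∃ y, d c y = 1 ∧ d u y < d u c ∧ ¬ d v y < d v c
      · obtain ⟨y, y1, y2, y3⟩ := h1
        exact (hcom u v x y hx y1 (by rintro rfl; exact y3 hvx) hux y2 y3).1
      · by_cases h2 : ∃ y, d c y = 1 ∧ d v y < d v c ∧ ¬ d u y < d u c
        · obtain ⟨y, y1, y2, y3⟩ := h2
          rw [M.comm u v]
          exact (hcom v u x y hx y1 (by rintro rfl; exact y3 hux) hvx y2 y3).2
        · exfalso
          push Not at h1 h2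
          apply hne
          have e1 := hXY v hv (X u) (hX u hu) (h1 _ (hX u hu) (hvX u hu))
          have e2 := hXY v hv (Y u) (hY u hu) (h1 _ (hY u hu) (hvY u hu))
          have e3 := hXY u hu (X v) (hX v hv) (h2 _ (hX v hv) (hvX v hv))
          have e4 := hXY u hu (Y v) (hY v hv) (h2 _ (hY v hv) (hvY v hv))
          rw [Sym2.eq_iff]
          grind
    refine ⟨fun v => if v = c then [(0, (0, 0, [], []), (0, 0, [], []))] else
      (d c v, ent (X v) v, ent (Y v) v) :: F (K v) v, ?_, ?_⟩
    · intro u hu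
      by_cases huc : u = c
      · simp [huc, hP0]
      · have hh := hF1 (K u) (hKc u huc) u ((hK u u).2 ⟨hu, huc, rfl⟩)
        simp only [huc, if_false, List.length_cons, List.mem_cons]
        refine ⟨by omega, ?_⟩
        rintro p (rfl | hp)
        · exact hP _ _ _ _
        · exact hh.2 p hp
    · intro u hu v hv
      by_cases huc : u = c
      · subst huc
        by_cases hvc : v = u
        · subst hvc
          simp [ldec, M.self]
        · simp [hvc, ldec, hid]
      · by_cases hvc : v = c
        · subst hvc
          simp [huc, ldec, hid, M.comm]
        · simp only [huc, hvc, if_false, ldec, hid, Nat.add_right_cancel_iff, hinj.eq_iff]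
          split_ifs with g1 g2 g3 g4 g5
          · have hs : s(X u, Y u) = s(X v, Y v) := Sym2.eq_iff.mpr g1
            have hKK : K u = K v := by simp only [K, hs]
            rw [hKK]
            exact hF2 (K v) (hKc v hvc) u ((hK v u).2 ⟨hu, huc, hs⟩) v ((hK v v).2 ⟨hv, hvc, rfl⟩)
          all_goals have hs : s(X u, Y u) ≠ s(X v, Y v) := fun h => g1 (Sym2.eq_iff.mp h)
          · rw [← g2]
            exact hcom2 u v _ huc hvc (hX u huc) (hvX u huc) (g2 ▸ hvX v hvc) hs
          · rw [← g3]
            exact hcom2 u v _ huc hvc (hX u huc) (hvX u huc) (g3 ▸ hvY v hvc) hs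
          · rw [← g4]
            exact hcom2 u v _ huc hvc (hY u huc) (hvY u huc) (g4 ▸ hvX v hvc) hs
          · rw [← g5]
            exact hcom2 u v _ huc hvc (hY u huc) (hvY u huc) (g5 ▸ hvY v hvc) hs
          · obtain ⟨m, m1, m2, m3⟩ := M.med c u v
            by_cases hm : c = m
            · subst hm
              rw [M.comm c u]; exact m2
            · exfalso
              obtain ⟨z, z1, z2⟩ := M.step c m hm
              have t1 := M.tri z m u
              have t2 := M.tri z m v
              have d1 := M.comm z u
              have d2 := M.comm z v
              have d3 := M.comm c u
              have d4 := M.comm c v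
              have e1 := hXY u huc z z1 (by omega)
              have e2 := hXY v hvc z z1 (by omega)
              grind

/-! ### Entries -/

theorem two_max {V : Type} [Fintype V] {d : V → V → ℕ} (M : Med d) (hQ : ¬ Med.CubeD d) (x v : V) :
    ∃ g1 g2, Med.Chain d x g1 ∧ Med.Chain d x g2 ∧ d x g1 + d g1 v = d x v ∧
      d x g2 + d g2 v = d x v ∧ ∀ w, Med.Chain d x w → d x w + d w v = d x v →
        d x w + d w g1 = d x g1 ∨ d x w + d w g2 = d x g2 := by
  classical
  let A : Finset V := Finset.univ.filter (fun w => Med.Chain d x w ∧ d x w + d w v = d x v)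
  have hA : ∀ w, w ∈ A ↔ Med.Chain d x w ∧ d x w + d w v = d x v := fun w => by simp [A]
  have hx : x ∈ A := by
    rw [hA]
    refine ⟨?_, by rw [M.self]; omega⟩
    intro a b ha hb
    rw [M.self] at ha hb
    have h1 : x = a := M.eq _ _ (by omega)
    subst h1
    left
    rw [M.self]; omega
  obtain ⟨g1, h1, h1m⟩ := Finset.exists_max_image A (fun w => d x w) ⟨x, hx⟩
  have h1' := (hA g1).1 h1
  by_cases hne : (A.filter (fun w => ¬ d x w + d w g1 = d x g1)).Nonempty
  · obtain ⟨g2, h2, h2m⟩ := Finset.exists_max_image _ (fun w => d x w) hne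
    rw [Finset.mem_filter] at h2
    have h2' := (hA g2).1 h2.1
    refine ⟨g1, g2, h1'.1, h2'.1, h1'.2, h2'.2, fun w hw hw' => ?_⟩
    by_contra hcon
    push Not at hcon
    have hwA := (hA w).2 ⟨hw, hw'⟩
    have m1 := h1m g2 h2.1
    have m2 := h1m w hwA
    have m3 := h2m w (Finset.mem_filter.mpr ⟨hwA, hcon.1⟩)
    have c1 := M.comm g1 g2
    have c2 := M.comm g1 w
    have c3 := M.comm g2 w
    have hh := h2.2
    have hc1 := hcon.1
    have hc2 := hcon.2
    exact M.antichain hQ h1'.1 h2'.1 hw h1'.2 h2'.2 hw' (by omega) (by omega) (by omega)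
      (by omega) (by omega) (by omega)
  · refine ⟨g1, g1, h1'.1, h1'.1, h1'.2, h1'.2, fun w hw hw' => ?_⟩
    left
    by_contra hcon
    exact hne ⟨w, Finset.mem_filter.mpr ⟨(hA w).2 ⟨hw, hw'⟩, hcon⟩⟩

/-- Gromov product at `x`. -/
def gp {V : Type} (d : V → V → ℕ) (x a b : V) : ℕ := (d x a + d x b - d a b) / 2

theorem gp_eq {V : Type} {d : V → V → ℕ} (M : Med d) {x a b m : V} (h1 : d x m + d m a = d x a)
    (h2 : d a m + d m b = d a b) (h3 : d x m + d m b = d x b) : gp d x a b = d x m := by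
  have := M.comm a m
  unfold gp
  omega

theorem gp_ge {V : Type} {d : V → V → ℕ} (M : Med d) {x a b m : V} (h1 : d x m + d m a = d x a)
    (h3 : d x m + d m b = d x b) : d x m ≤ gp d x a b := by
  have := M.comm a m
  have := M.tri a m b
  unfold gp
  omega

theorem gp_ult {V : Type} {d : V → V → ℕ} (M : Med d) {x a b c : V} (hb : Med.Chain d x b) :
    min (gp d x a b) (gp d x b c) ≤ gp d x a c := by
  obtain ⟨m, m1, m2, m3⟩ := M.med x a b
  obtain ⟨n, n1, n2, n3⟩ := M.med x b c
  rw [gp_eq M m1 m2 m3, gp_eq M n1 n2 n3]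
  rcases hb m n m3 n1 with h | h
  · exact le_trans (min_le_left _ _) (gp_ge M m1 (M.le_trans h n3))
  · exact le_trans (min_le_right _ _) (gp_ge M (M.le_trans h m1) n3)

theorem entries {V : Type} [Fintype V] {d : V → V → ℕ} (M : Med d) (hQ : ¬ Med.CubeD d)
    (n k : ℕ) (hn : Fintype.card V = n) (hk : n < 2 ^ k) (hd : ∀ x y, d x y ≤ n)
    (idx : V → ℕ) (hinj : Function.Injective idx) (hidx : ∀ v, idx v < n) :
    ∃ ent : V → V → Ent, (∀ x v, (ent x v).1 = idx x + 1) ∧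
      (∀ x u v m, d x m + d m u = d x u → d u m + d m v = d u v → d x m + d m v = d x v →
        Med.Chain d x m → ed (ent x u) (ent x v) = d u v) ∧
      (∀ x v, (ent x v).2.1 = d x v ∧
        ((ent x v).2.2.1.length ≤ k ∧ ∀ p ∈ (ent x v).2.2.1, p.1 ≤ n ∧ p.2 ≤ n) ∧
        ((ent x v).2.2.2.length ≤ k ∧ ∀ p ∈ (ent x v).2.2.2, p.1 ≤ n ∧ p.2 ≤ n)) := by
  classical
  have htl : ∀ x, ∃ lam : V → List (ℕ × ℕ),
      (∀ u, Med.Chain d x u → (lam u).length ≤ k ∧ ∀ p ∈ lam u, p.1 ≤ n ∧ p.2 ≤ n) ∧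
      ∀ u, Med.Chain d x u → ∀ v, Med.Chain d x v → tdec (lam u) (lam v) = gp d x u v := by
    intro x
    obtain ⟨lam, h1, h2⟩ := tree_label n idx hinj hidx (gp d x)
      (fun a b => by
        have := hd x a
        have := hd x b
        unfold gp
        omega) {u | Med.Chain d x u}
      (fun a _ b _ => by unfold gp; rw [M.comm a b, Nat.add_comm])
      (fun a _ b hb c _ => gp_ult M hb) k (Finset.univ.filter (fun u => Med.Chain d x u))
      (fun a ha => (Finset.mem_filter.mp ha).2)
      (lt_of_le_of_lt (Finset.card_le_univ _) (by rw [hn]; exact hk))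
    have hm : ∀ u, Med.Chain d x u → u ∈ Finset.univ.filter (fun u => Med.Chain d x u) :=
      fun u hu => Finset.mem_filter.mpr ⟨Finset.mem_univ u, hu⟩
    exact ⟨lam, fun u hu => h1 u (hm u hu), fun u hu v hv => h2 u (hm u hu) v (hm v hv)⟩
  choose lam hl1 hl2 using htl
  choose g1 g2 c1 c2 i1 i2 hmax using two_max M hQ
  refine ⟨fun x v => (idx x + 1, d x v, lam x (g1 x v), lam x (g2 x v)), fun _ _ => rfl, ?_, ?_⟩
  · intro x u v m m1 m2 m3 hm
    have hle : ∀ g h, d x g + d g u = d x u → d x h + d h v = d x v → gp d x g h ≤ d x m := by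
      intro g h hg hh
      obtain ⟨p, p1, p2, p3⟩ := M.med x g h
      rw [gp_eq M p1 p2 p3, ← gp_eq M m1 m2 m3]
      exact gp_ge M (M.le_trans p1 hg) (M.le_trans p3 hh)
    have a11 := hle _ _ (i1 x u) (i1 x v)
    have a12 := hle _ _ (i1 x u) (i2 x v)
    have a21 := hle _ _ (i2 x u) (i1 x v)
    have a22 := hle _ _ (i2 x u) (i2 x v)
    have hge : d x m ≤ gp d x (g1 x u) (g1 x v) ∨ d x m ≤ gp d x (g1 x u) (g2 x v) ∨
        d x m ≤ gp d x (g2 x u) (g1 x v) ∨ d x m ≤ gp d x (g2 x u) (g2 x v) := by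
      rcases hmax x u m hm m1 with h | h <;> rcases hmax x v m hm m3 with h' | h'
      · exact Or.inl (gp_ge M h h')
      · exact Or.inr (Or.inl (gp_ge M h h'))
      · exact Or.inr (Or.inr (Or.inl (gp_ge M h h')))
      · exact Or.inr (Or.inr (Or.inr (gp_ge M h h')))
    have hc := M.comm u m
    simp only [ed, hl2 x _ (c1 x u) _ (c1 x v), hl2 x _ (c1 x u) _ (c2 x v),
      hl2 x _ (c2 x u) _ (c1 x v), hl2 x _ (c2 x u) _ (c2 x v)]
    omega
  · intro x v
    exact ⟨rfl, hl1 x _ (c1 x v), hl1 x _ (c2 x v)⟩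

/-! ### Encoding into bits -/

/-- Self-delimiting encodings. -/
def PF {α : Type} (f : α → List Bool) : Prop :=
  ∀ a b s t, f a ++ s = f b ++ t → a = b ∧ s = t

/-- Self-delimiting encoding of naturals. -/
def encN : ℕ → List Bool
  | 0 => [false]
  | n + 1 => true :: decide ((n + 1) % 2 = 1) :: encN ((n + 1) / 2)
decreasing_by omega

theorem encN_pf : PF encN := by
  intro a
  induction a using Nat.strong_induction_on with
  | _ a ih =>
  intro b s t h
  cases a with
  | zero =>
    cases b with
    | zero => simpa [encN] using h
    | succ b => simp [encN] at h
  | succ a =>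
    cases b with
    | zero => simp [encN] at h
    | succ b =>
      rw [encN, encN] at h
      simp only [List.cons_append, List.cons.injEq, true_and, decide_eq_decide] at h
      obtain ⟨h1, h2⟩ := ih ((a + 1) / 2) (by omega) _ _ _ h.2
      refine ⟨?_, h2⟩
      have := h.1
      omega

theorem encN_len (k : ℕ) : ∀ a, a < 2 ^ k → (encN a).length ≤ 2 * k + 1 := by
  induction k with
  | zero =>
    intro a ha
    have : a = 0 := by simpa using ha
    subst this
    simp [encN]
  | succ k ih =>
    intro a ha
    cases a with
    | zero => simp [encN]
    | succ a =>
      rw [encN]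
      have := ih ((a + 1) / 2) (by rw [pow_succ] at ha; omega)
      simp only [List.length_cons]
      omega

/-- Encoding of pairs. -/
def encP {α β : Type} (f : α → List Bool) (g : β → List Bool) (p : α × β) : List Bool :=
  f p.1 ++ g p.2

theorem encP_pf {α β : Type} {f : α → List Bool} {g : β → List Bool} (hf : PF f) (hg : PF g) :
    PF (encP f g) := by
  rintro ⟨a, b⟩ ⟨a', b'⟩ s t h
  simp only [encP, List.append_assoc] at h
  obtain ⟨h1, h2⟩ := hf _ _ _ _ h
  obtain ⟨h3, h4⟩ := hg _ _ _ _ h2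
  exact ⟨by rw [h1, h3], h4⟩

/-- Encoding of lists. -/
def encL {α : Type} (f : α → List Bool) : List α → List Bool
  | [] => [false]
  | a :: l => true :: (f a ++ encL f l)

theorem encL_pf {α : Type} {f : α → List Bool} (hf : PF f) : PF (encL f) := by
  intro l
  induction l with
  | nil =>
    intro b s t h
    cases b with
    | nil => simpa [encL] using h
    | cons b l => simp [encL] at h
  | cons a l ih =>
    intro b s t h
    cases b with
    | nil => simp [encL] at h
    | cons b l' =>
      simp only [encL, List.cons_append, List.cons.injEq, true_and, List.append_assoc] at h
      obtain ⟨h1, h2⟩ := hf _ _ _ _ h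
      obtain ⟨h3, h4⟩ := ih _ _ _ h2
      exact ⟨by rw [h1, h3], h4⟩

theorem encL_len {α : Type} (f : α → List Bool) (B : ℕ) (l : List α)
    (h : ∀ a ∈ l, (f a).length ≤ B) : (encL f l).length ≤ l.length * (B + 1) + 1 := by
  induction l with
  | nil => simp [encL]
  | cons a l ih =>
    have h1 := ih (fun b hb => h b (List.mem_cons_of_mem _ hb))
    have h2 := h a List.mem_cons_self
    simp only [encL, List.length_cons, List.length_append, Nat.add_mul]
    omega

/-- Encoding of tree labels. -/
def encT : List (ℕ × ℕ) → List Bool := encL (encP encN encN)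

/-- Encoding of entries. -/
def encE : Ent → List Bool := encP encN (encP encN (encP encT encT))

/-- Encoding of levels. -/
def encV : Lev → List Bool := encP encN (encP encE encE)

theorem encT_pf : PF encT := encL_pf (encP_pf encN_pf encN_pf)

theorem encE_pf : PF encE := encP_pf encN_pf (encP_pf encN_pf (encP_pf encT_pf encT_pf))

theorem encV_pf : PF encV := encP_pf encN_pf (encP_pf encE_pf encE_pf)

theorem encT_len (n k : ℕ) (hk : n < 2 ^ k) (l : List (ℕ × ℕ)) (hl : l.length ≤ k)
    (h : ∀ p ∈ l, p.1 ≤ n ∧ p.2 ≤ n) : (encT l).length ≤ k * (4 * k + 3) + 1 := by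
  have h1 := encL_len (encP encN encN) (4 * k + 2) l (by
    intro a ha
    have h1 := encN_len k a.1 (by have := h a ha; omega)
    have h2 := encN_len k a.2 (by have := h a ha; omega)
    simp only [encP, List.length_append]
    omega)
  have h2 : l.length * (4 * k + 2 + 1) ≤ k * (4 * k + 3) := Nat.mul_le_mul_right _ hl
  unfold encT
  omega

theorem encE_len (n k : ℕ) (hk : n < 2 ^ k) (e : Ent) (h1 : e.1 ≤ n) (h2 : e.2.1 ≤ n)
    (h3 : (encT e.2.2.1).length ≤ k * (4 * k + 3) + 1)
    (h4 : (encT e.2.2.2).length ≤ k * (4 * k + 3) + 1) :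
    (encE e).length ≤ 2 * (k * (4 * k + 3)) + 4 * k + 4 := by
  have a1 := encN_len k e.1 (by omega)
  have a2 := encN_len k e.2.1 (by omega)
  simp only [encE, encP, List.length_append]
  omega

theorem metric_main {V : Type} [Fintype V] {d : V → V → ℕ} (M : Med d)
    (hQ : ¬ Med.CubeD d) (hd : ∀ x y, d x y ≤ Fintype.card V) (h2 : 2 ≤ Fintype.card V) :
    ∃ lab : V → List Lev,
      (∀ u, (encL encV (lab u)).length ≤ 1000 * (Nat.log 2 (Fintype.card V)) ^ 3) ∧
      ∀ u v, ldec (lab u) (lab v) = d u v := by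
  classical
  generalize hn : Fintype.card V = n at *
  have hne : Nonempty V := Fintype.card_pos_iff.mp (by omega)
  let eqv := Fintype.equivFin V
  let idx : V → ℕ := fun v => eqv v
  have hinj : Function.Injective idx := fun a b h => eqv.injective (Fin.ext h)
  have hidx : ∀ v, idx v < n := fun v => hn ▸ (eqv v).2
  have hk : n < 2 ^ (Nat.log 2 n + 1) := Nat.lt_pow_succ_log_self (by norm_num) n
  have hb : 1 ≤ Nat.log 2 n := Nat.log_pos (by norm_num) h2
  generalize Nat.log 2 n = b at *
  obtain ⟨ent, e1, e2, e3⟩ := entries M hQ n (b + 1) hn hk hd idx hinj hidx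
  generalize hB : (b + 1) * (4 * (b + 1) + 3) = B
  have hE : ∀ x v, (encE (ent x v)).length ≤ 2 * B + 4 * (b + 1) + 4 := by
    intro x v
    have := e3 x v
    rw [← hB]
    exact encE_len n (b + 1) hk _ (by have := e1 x v; have := hidx x; omega)
      (by have := hd x v; omega) (encT_len n _ hk _ this.2.1.1 this.2.1.2)
      (encT_len n _ hk _ this.2.2.1 this.2.2.2)
  obtain ⟨lab, l1, l2⟩ := main_rec M hQ idx hinj ent e1 e2
    (fun p => (encV p).length ≤ 4 * B + 10 * (b + 1) + 9)
    (by simp [encV, encP, encE, encT, encL, encN])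
    (by
      intro c x y v
      have a1 := encN_len (b + 1) (d c v) (by have := hd c v; omega)
      have a2 := hE x v
      have a3 := hE y v
      simp only [encV, encP, List.length_append]
      omega) (b + 1) Finset.univ (by rw [Finset.card_univ, hn]; exact hk)
  refine ⟨lab, fun u => ?_, fun u v => l2 u (Finset.mem_univ u) v (Finset.mem_univ v)⟩
  have h3 := l1 u (Finset.mem_univ u)
  have h4 := encL_len encV _ (lab u) h3.2
  have h5 := Nat.mul_le_mul_right (4 * B + 10 * (b + 1) + 9 + 1) h3.1
  refine le_trans h4 (le_trans (Nat.add_le_add_right h5 1) ?_)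
  rw [← hB]
  obtain ⟨t, rfl⟩ := Nat.exists_eq_add_of_le hb
  ring_nf
  nlinarith [Nat.zero_le t, Nat.zero_le (t ^ 2), Nat.zero_le (t ^ 3)]

/-! ### From graphs to metrics -/

theorem med_of_graph {V : Type} (G : SimpleGraph V) (h : MedianGraph G) :
    Med (fun x y => G.dist x y) := by
  obtain ⟨hc, hm⟩ := h
  refine ⟨fun x => by simp, fun x y hxy => ?_, fun x y => G.dist_comm, fun x y z => hc.dist_triangle,
    ?_, ?_, ?_⟩
  · exact hc.dist_eq_zero_iff.mp hxy
  · intro x y hxy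
    obtain ⟨p, hp⟩ := hc.exists_walk_length_eq_dist x y
    cases p with
    | nil => exact absurd rfl hxy
    | @cons _ a _ ha q =>
      refine ⟨a, SimpleGraph.dist_eq_one_iff_adj.mpr ha, ?_⟩
      have h1 := SimpleGraph.dist_le q
      have h2 := hc.dist_triangle (u := x) (v := a) (w := y)
      have h3 := SimpleGraph.dist_eq_one_iff_adj.mpr ha
      rw [SimpleGraph.Walk.length_cons] at hp
      omega
  · intro x y z
    obtain ⟨m, ⟨h1, h2, h3⟩, -⟩ := hm x y z
    refine ⟨m, h1, h2, ?_⟩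
    simp only [gInterval, Set.mem_ofPred_eq] at h3
    have := G.dist_comm (u := z) (v := m)
    have := G.dist_comm (u := x) (v := m)
    have := G.dist_comm (u := x) (v := z)
    omega
  · intro x y z m m' h1 h2 h3 h1' h2' h3'
    have aux : ∀ m, G.dist x m + G.dist m z = G.dist x z →
        G.dist z m + G.dist m x = G.dist z x := by
      intro m h
      have := G.dist_comm (u := z) (v := m)
      have := G.dist_comm (u := x) (v := m)
      have := G.dist_comm (u := x) (v := z)
      omega
    exact (hm x y z).unique ⟨h1, h2, aux m h3⟩ ⟨h1', h2', aux m' h3'⟩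

theorem dist_le_card {V : Type} [Fintype V] (G : SimpleGraph V) (h : G.Connected) (x y : V) :
    G.dist x y ≤ Fintype.card V := by
  obtain ⟨p, hp, hl⟩ := h.exists_path_of_dist x y
  have := hp.length_lt
  omega

/-- The vertex of the cube indexed by three bits. -/
def cubeMap {V : Type} (z b1 b2 b3 c12 c13 c23 e : V) : Bool → Bool → Bool → V
  | false, false, false => z
  | true, false, false => b1
  | false, true, false => b2
  | false, false, true => b3
  | true, true, false => c12
  | true, false, true => c13
  | false, true, true => c23
  | true, true, true => e

theorem symmDiff_bits : ∀ A B : Finset (Fin 3), (symmDiff A B).card = 1 ↔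
    ((xor (decide (0 ∈ A)) (decide (0 ∈ B))).toNat + (xor (decide (1 ∈ A)) (decide (1 ∈ B))).toNat +
      (xor (decide (2 ∈ A)) (decide (2 ∈ B))).toNat = 1) := by
  decide

theorem eq_of_bits : ∀ A B : Finset (Fin 3), decide (0 ∈ A) = decide (0 ∈ B) →
    decide (1 ∈ A) = decide (1 ∈ B) → decide (2 ∈ A) = decide (2 ∈ B) → A = B := by
  decide

theorem cube_of_cubeD {V : Type} (G : SimpleGraph V) (M : Med (fun x y => G.dist x y))
    (h : Med.CubeD (fun x y => G.dist x y)) : HasInducedCube G 3 := by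
  obtain ⟨z, b1, b2, b3, c12, c13, c23, e, n1, n2, n3, n4, n5, n6, h1, h2, h3, h4, h5, h6,
    p1, p2, p3, p4, p5, p6, p7, p8, p9, x, k, q1, q2, q3, q4, q5, q6, q7, q8⟩ := h
  have lev : ∀ {a b : V}, G.Adj a b → G.dist x a = G.dist x b + 1 ∨ G.dist x b = G.dist x a + 1 :=
    fun {a b} hab => M.bip (SimpleGraph.dist_eq_one_iff_adj.mpr hab) x
  simp only [ne_eq, SimpleGraph.dist_eq_one_iff_adj] at h1 h2 h3 h4 h5 h6 p1 p2 p3 p4 p5 p6 p7 p8 p9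
  simp only at q1 q2 q3 q4 q5 q6 q7 q8
  refine ⟨fun A => cubeMap z b1 b2 b3 c12 c13 c23 e (decide (0 ∈ A)) (decide (1 ∈ A))
    (decide (2 ∈ A)), ?_, fun _ => Set.mem_univ _, ?_⟩
  · intro A B hAB
    have key : ∀ i j l i' j' l' : Bool, cubeMap z b1 b2 b3 c12 c13 c23 e i j l =
        cubeMap z b1 b2 b3 c12 c13 c23 e i' j' l' → i = i' ∧ j = j' ∧ l = l' := by
      intro i j l i' j' l' hh
      have hh' := congrArg (G.dist x) hh
      cases i <;> cases j <;> cases l <;> cases i' <;> cases j' <;> cases l' <;>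
        simp only [cubeMap] at hh hh' <;>
        first
          | exact ⟨rfl, rfl, rfl⟩
          | (exfalso; omega)
          | exact absurd hh (by assumption)
          | exact absurd hh.symm (by assumption)
    obtain ⟨a, b, c⟩ := key _ _ _ _ _ _ hAB
    exact eq_of_bits A B a b c
  · intro A B
    have key : ∀ i j l i' j' l' : Bool, G.Adj (cubeMap z b1 b2 b3 c12 c13 c23 e i j l)
        (cubeMap z b1 b2 b3 c12 c13 c23 e i' j' l') ↔
        ((xor i i').toNat + (xor j j').toNat + (xor l l').toNat = 1) := by
      intro i j l i' j' l'
      cases i <;> cases j <;> cases l <;> cases i' <;> cases j' <;> cases l' <;>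
        simp only [cubeMap] <;>
        first
          | exact iff_of_true (by assumption) (by decide)
          | exact iff_of_true (SimpleGraph.Adj.symm (by assumption)) (by decide)
          | exact iff_of_false (by assumption) (by decide)
          | exact iff_of_false (fun hh => absurd hh.symm (by assumption)) (by decide)
          | exact iff_of_false (fun hh => by have := lev hh; omega) (by decide)
    rw [symmDiff_bits]
    exact key _ _ _ _ _ _

/-- **Distance labeling scheme for cube-free median graphs.** There exist a constant
`C > 0` and a decoding function `D` such that every finite cube-free median graph on
`n ≥ 2` vertices admits a labeling with labels of length at most `C·(log₂ n)³`
from which `D` recovers all distances. -/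
theorem distance_labeling_cube_free_median :
    ∃ C : ℕ, 0 < C ∧ ∃ D : List Bool × List Bool → ℕ,
      ∀ (V : Type) [Fintype V] (G : SimpleGraph V),
        MedianGraph G → CubeFree G → 2 ≤ Fintype.card V →
        ∃ ℓ : V → List Bool,
          (∀ v : V, (ℓ v).length ≤ C * (Nat.log 2 (Fintype.card V)) ^ 3) ∧
          (∀ u v : V, D (ℓ u, ℓ v) = G.dist u v) := by
  classical
  have hpf : PF (encL encV) := encL_pf encV_pf
  have hinj : Function.Injective (encL encV) := fun a b h =>
    (hpf a b [] [] (by rw [h])).1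
  have hli := Function.leftInverse_invFun hinj
  refine ⟨1000, by norm_num, fun p => ldec (Function.invFun (encL encV) p.1)
    (Function.invFun (encL encV) p.2), ?_⟩
  intro V _ G hM hC h2
  have M := med_of_graph G hM
  obtain ⟨lab, l1, l2⟩ := metric_main M (fun h => hC (cube_of_cubeD G M h))
    (dist_le_card G hM.1) h2
  refine ⟨fun v => encL encV (lab v), l1, fun u v => ?_⟩
  simp only [hli (lab u), hli (lab v)]
  exact l2 u v
end

section
/- If u and v are any two vertices of a cube-free median graph G, then v has at most two neighbors in the interval I(u,v). -/
open SimpleGraph Set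

section helpers
variable {V : Type*} {G : SimpleGraph V}

lemma MedianGraph.level (hG : MedianGraph G) (u : V) {x y : V} (h : G.Adj x y) :
    G.dist u x = G.dist u y + 1 ∨ G.dist u y = G.dist u x + 1 := by
  obtain ⟨m, ⟨h1, h2, h3⟩, -⟩ := hG.2 u x y
  have hxy : G.dist x y = 1 := dist_eq_one_iff_adj.2 h
  simp only [gInterval, Set.mem_setOf_eq] at h1 h2 h3
  rw [dist_comm (u := y) (v := m), dist_comm (u := m) (v := u), dist_comm (u := y) (v := u)] at h3
  rw [dist_comm (u := m) (v := x)] at h1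
  rcases Nat.eq_zero_or_pos (G.dist x m) with h0 | h0
  · have := hG.1.dist_eq_zero_iff.1 h0
    subst this
    omega
  · have h0' : G.dist m y = 0 := by omega
    have := hG.1.dist_eq_zero_iff.1 h0'
    subst this
    omega

lemma MedianGraph.dist_two (hG : MedianGraph G) {v x y : V} (hx : G.Adj v x) (hy : G.Adj v y)
    (hne : x ≠ y) : G.dist x y = 2 := by
  have h1 := hG.1.dist_triangle (u := x) (v := v) (w := y)
  have hx1 : G.dist x v = 1 := dist_eq_one_iff_adj.2 hx.symm
  have hy1 : G.dist v y = 1 := dist_eq_one_iff_adj.2 hy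
  have h0 := hG.1.pos_dist_of_ne hne
  have := hG.level x hy
  omega

lemma MedianGraph.quad (hG : MedianGraph G) (u : V) {v x y : V} (hx : G.Adj v x) (hy : G.Adj v y)
    (hne : x ≠ y) (hl : G.dist u x = G.dist u y) :
    ∃ m, G.Adj m x ∧ G.Adj m y ∧ G.dist u x = G.dist u m + 1 := by
  obtain ⟨m, ⟨h1, h2, h3⟩, -⟩ := hG.2 u x y
  have hxy := hG.dist_two hx hy hne
  simp only [gInterval, Set.mem_setOf_eq] at h1 h2 h3
  rw [dist_comm (u := y) (v := m), dist_comm (u := m) (v := u), dist_comm (u := y) (v := u)] at h3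
  rw [dist_comm (u := m) (v := x)] at h1
  refine ⟨m, dist_eq_one_iff_adj.1 ?_, dist_eq_one_iff_adj.1 ?_, ?_⟩
  · rw [dist_comm]; omega
  · omega
  · omega

/-- no `K_{2,3}` -/
lemma MedianGraph.no_k23 (hG : MedianGraph G) {p q x y z : V} (hxy : x ≠ y) (hyz : y ≠ z)
    (hzx : z ≠ x) (hpx : G.Adj p x) (hpy : G.Adj p y) (hpz : G.Adj p z)
    (hqx : G.Adj q x) (hqy : G.Adj q y) (hqz : G.Adj q z) : p = q := by
  have e1 := hG.dist_two hpx hpy hxy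
  have e2 := hG.dist_two hpy hpz hyz
  have e3 := hG.dist_two hpz hpx hzx
  have key : ∀ r, G.Adj r x → G.Adj r y → G.Adj r z →
      r ∈ gInterval G x y ∧ r ∈ gInterval G y z ∧ r ∈ gInterval G z x := by
    intro r hx hy hz
    simp only [gInterval, Set.mem_setOf_eq, e1, e2, e3, dist_eq_one_iff_adj.2 hx,
      dist_eq_one_iff_adj.2 hy, dist_eq_one_iff_adj.2 hz, dist_eq_one_iff_adj.2 hx.symm,
      dist_eq_one_iff_adj.2 hy.symm, dist_eq_one_iff_adj.2 hz.symm, and_self]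
  exact (hG.2 x y z).unique (key p hpx hpy hpz) (key q hqx hqy hqz)

lemma MedianGraph.center (hG : MedianGraph G) {x y z a b c : V} (hxy : x ≠ y) (hyz : y ≠ z)
    (hzx : z ≠ x) (hax : G.Adj a x) (hay : G.Adj a y) (hby : G.Adj b y) (hbz : G.Adj b z)
    (hcz : G.Adj c z) (hcx : G.Adj c x) : ∃ p, G.Adj p x ∧ G.Adj p y ∧ G.Adj p z := by
  have e1 := hG.dist_two hax hay hxy
  have e2 := hG.dist_two hby hbz hyz
  have e3 := hG.dist_two hcz hcx hzx
  obtain ⟨m, ⟨h1, h2, h3⟩, -⟩ := hG.2 x y z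
  simp only [gInterval, Set.mem_setOf_eq] at h1 h2 h3
  rw [dist_comm (u := x) (v := m)] at h1
  rw [dist_comm (u := y) (v := m)] at h2
  rw [dist_comm (u := z) (v := m)] at h3
  exact ⟨m, dist_eq_one_iff_adj.1 (by omega), dist_eq_one_iff_adj.1 (by omega),
    dist_eq_one_iff_adj.1 (by omega)⟩

lemma cube_card (A B : Finset (Fin 3)) : (symmDiff A B).card = 1 ↔
    (decide (0 ∈ A) ^^ decide (0 ∈ B)).toNat + (decide (1 ∈ A) ^^ decide (1 ∈ B)).toNat +
      (decide (2 ∈ A) ^^ decide (2 ∈ B)).toNat = 1 := by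
  revert A B
  decide

lemma cube_of (g : Bool → Bool → Bool → V)
    (hinj : ∀ x y z x' y' z', g x y z = g x' y' z' → x = x' ∧ y = y' ∧ z = z')
    (hadj : ∀ x y z x' y' z', G.Adj (g x y z) (g x' y' z') ↔
      (x ^^ x').toNat + (y ^^ y').toNat + (z ^^ z').toNat = 1) : HasInducedCube G 3 := by
  refine ⟨fun A => g (decide (0 ∈ A)) (decide (1 ∈ A)) (decide (2 ∈ A)), ?_, fun _ => trivial, ?_⟩
  · intro A B h
    obtain ⟨h0, h1, h2⟩ := hinj _ _ _ _ _ _ h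
    simp only [decide_eq_decide] at h0 h1 h2
    ext i
    fin_cases i
    · exact h0
    · exact h1
    · exact h2
  · intro A B
    rw [cube_card]
    exact hadj _ _ _ _ _ _

lemma three_nbrs (hG : MedianGraph G) (hcf : CubeFree G) {u v a b c : V}
    (hab : a ≠ b) (hbc : b ≠ c) (hca : c ≠ a) (ha : G.Adj v a) (hb : G.Adj v b) (hc : G.Adj v c)
    (la : G.dist u v = G.dist u a + 1) (lb : G.dist u v = G.dist u b + 1)
    (lc : G.dist u v = G.dist u c + 1) : False := by
  obtain ⟨x, xa, xb, lx⟩ := hG.quad u ha hb hab (by omega)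
  obtain ⟨y, yb, yc, ly⟩ := hG.quad u hb hc hbc (by omega)
  obtain ⟨z, zc, za, lz⟩ := hG.quad u hc ha hca (by omega)
  have nv : ∀ m, G.dist u m + 2 = G.dist u v → G.Adj m a → G.Adj m b → G.Adj m c → False := by
    intro m hm h1 h2 h3
    have := hG.no_k23 hab hbc hca ha hb hc h1 h2 h3
    subst this
    omega
  have nxc : ¬ G.Adj x c := fun h => nv x (by omega) xa xb h
  have nya : ¬ G.Adj y a := fun h => nv y (by omega) h yb yc
  have nzb : ¬ G.Adj z b := fun h => nv z (by omega) za h zc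
  have hxy : x ≠ y := by rintro rfl; exact nxc yc
  have hyz : y ≠ z := by rintro rfl; exact nya za
  have hzx : z ≠ x := by rintro rfl; exact nzb xb
  obtain ⟨p, px, py, pz⟩ := hG.center hxy hyz hzx xb.symm yb.symm yc.symm zc.symm za.symm xa.symm
  obtain ⟨q, qz, qx, lq⟩ := hG.quad u za.symm xa.symm hzx (by omega)
  have hpq : p = q := by
    by_contra hpq
    have hpa : p ≠ a := by rintro rfl; exact nya py.symm
    have hqa : a ≠ q := by rintro rfl; omega
    exact hzx (hG.no_k23 hpa hqa (Ne.symm hpq) pz.symm za qz.symm px.symm xa qx.symm)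
  subst hpq
  have lev : ∀ s t, G.Adj s t → _ := fun s t h => hG.level u h
  apply hcf
  refine cube_of (fun i j k => match i, j, k with
    | false, false, false => v
    | true, false, false => a
    | false, true, false => b
    | false, false, true => c
    | true, true, false => x
    | false, true, true => y
    | true, false, true => z
    | true, true, true => p) ?_ ?_
  · intro i j k i' j' k' h
    rcases i <;> rcases j <;> rcases k <;> rcases i' <;> rcases j' <;> rcases k' <;>
      simp only at h <;> grind
  · intro i j k i' j' k'
    rcases i <;> rcases j <;> rcases k <;> rcases i' <;> rcases j' <;> rcases k' <;>
      simp only [Bool.xor_self, Bool.xor_true, Bool.xor_false, Bool.not_true, Bool.not_false,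
        Bool.toNat_true, Bool.toNat_false] <;>
      grind [SimpleGraph.adj_comm, SimpleGraph.irrefl]

end helpers

/-- In a cube-free median graph, any vertex `v` has at most two neighbors in the
interval `I(u,v)`. -/
theorem two_neighbors_in_interval {V : Type*} (G : SimpleGraph V)
    (hG : MedianGraph G) (hcf : CubeFree G) (u v : V) :
    ∃ a b : V, {w : V | G.Adj v w ∧ w ∈ gInterval G u v} ⊆ {a, b} := by
  have key : ∀ w, w ∈ {w : V | G.Adj v w ∧ w ∈ gInterval G u v} →
      G.Adj v w ∧ G.dist u v = G.dist u w + 1 := by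
    rintro w ⟨h, hw⟩
    simp only [gInterval, Set.mem_setOf_eq, dist_eq_one_iff_adj.2 h.symm] at hw
    exact ⟨h, hw.symm⟩
  by_contra! hno
  obtain ⟨a, ha, -⟩ := Set.not_subset.1 (hno v v)
  obtain ⟨b, hb, hb'⟩ := Set.not_subset.1 (hno a a)
  obtain ⟨c, hc, hc'⟩ := Set.not_subset.1 (hno a b)
  simp only [Set.mem_insert_iff, Set.mem_singleton_iff, or_self, not_or] at hb' hc'
  have ka := key a ha
  have kb := key b hb
  have kc := key c hc
  exact three_nbrs hG hcf (Ne.symm hb') (Ne.symm hc'.2) hc'.1 ka.1 kb.1 kc.1 ka.2 kb.2 kc.2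
end

section
/- For any vertex z of a median graph G, the star St(z) is a gated set of vertices of G. -/
open SimpleGraph Set

namespace StarGated

variable {V : Type*} {G : SimpleGraph V}

theorem med_ex (hG : MedianGraph G) (x y z : V) : ∃ m, G.dist x m + G.dist m y = G.dist x y ∧
    G.dist y m + G.dist m z = G.dist y z ∧ G.dist z m + G.dist m x = G.dist z x := by
  obtain ⟨m, hm, -⟩ := hG.2 x y z
  exact ⟨m, hm⟩

theorem med_unique (hG : MedianGraph G) (x y z p q : V)
    (h1 : G.dist x p + G.dist p y = G.dist x y)
    (h2 : G.dist y p + G.dist p z = G.dist y z)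
    (h3 : G.dist z p + G.dist p x = G.dist z x)
    (k1 : G.dist x q + G.dist q y = G.dist x y)
    (k2 : G.dist y q + G.dist q z = G.dist y z)
    (k3 : G.dist z q + G.dist q x = G.dist z x) : p = q :=
  (hG.2 x y z).unique ⟨h1, h2, h3⟩ ⟨k1, k2, k3⟩

theorem bip (hG : MedianGraph G) {a b : V} (h : G.Adj a b) (v : V) :
    G.dist v b = G.dist v a + 1 ∨ G.dist v a = G.dist v b + 1 := by
  have h1 : G.dist a b = 1 := dist_eq_one_iff_adj.2 h
  have t1 := hG.1.dist_triangle (u := v) (v := a) (w := b)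
  have t2 := hG.1.dist_triangle (u := v) (v := b) (w := a)
  have e1 := G.dist_comm (u := a) (v := b)
  obtain ⟨m, m1, m2, m3⟩ := med_ex hG a b v
  have e2 := G.dist_comm (u := b) (v := m)
  have e3 := G.dist_comm (u := a) (v := m)
  have e4 := G.dist_comm (u := v) (v := m)
  have e5 := G.dist_comm (u := v) (v := b)
  omega

/-- Neighbours of `z` on geodesics to `v`. -/
def N (G : SimpleGraph V) (z v : V) : Set V := {a | G.Adj z a ∧ G.dist a v + 1 = G.dist z v}

theorem N_mono (hG : MedianGraph G) {z x y : V} (h : G.dist z x + G.dist x y = G.dist z y) :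
    N G z x ⊆ N G z y := by
  rintro a ⟨ha, h1⟩
  refine ⟨ha, ?_⟩
  have h2 := dist_eq_one_iff_adj.2 ha
  have t1 := hG.1.dist_triangle (u := a) (v := x) (w := y)
  have t2 := hG.1.dist_triangle (u := z) (v := a) (w := y)
  omega

/-- An edge is parallel to at most one edge at `z`. -/
theorem par (hG : MedianGraph G) {z y y' a b : V} (hy : G.Adj y' y) (ha : G.Adj z a)
    (hb : G.Adj z b) (hzy : G.dist z y' + 1 = G.dist z y)
    (a1 : G.dist a y + 1 = G.dist z y) (b1 : G.dist b y + 1 = G.dist z y)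
    (a2 : G.dist a y' = G.dist z y' + 1) (b2 : G.dist b y' = G.dist z y' + 1) : a = b := by
  by_contra hab
  have ha1 := dist_eq_one_iff_adj.2 ha
  have hb1 := dist_eq_one_iff_adj.2 hb
  have hy1 := dist_eq_one_iff_adj.2 hy
  have hab0 : G.dist a b ≠ 0 := fun h => hab (hG.1.dist_eq_zero_iff.1 h)
  have e1 := G.dist_comm (u := a) (v := z)
  have e2 := G.dist_comm (u := b) (v := z)
  have hab2 : G.dist a b = 2 := by
    have := bip hG hb a
    omega
  obtain ⟨p, p1, p2, p3⟩ := med_ex hG a b y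
  have e3 := G.dist_comm (u := p) (v := y)
  have e4 := G.dist_comm (u := p) (v := b)
  have e5 := G.dist_comm (u := p) (v := a)
  have e6 := G.dist_comm (u := a) (v := y)
  have e8 := G.dist_comm (u := z) (v := y)
  have e7 := G.dist_comm (u := y') (v := y)
  have e9 := G.dist_comm (u := y') (v := p)
  have e10 := G.dist_comm (u := y') (v := a)
  have e11 := G.dist_comm (u := y') (v := z)
  have t1 := hG.1.dist_triangle (u := p) (v := y) (w := y')
  have t2 := hG.1.dist_triangle (u := a) (v := p) (w := y')
  have hpz : p = z := by
    apply med_unique hG a b y' <;> omega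
  subst hpz
  omega

theorem N_sub (hG : MedianGraph G) {z y y' : V} (hy : G.Adj y' y)
    (hzy : G.dist z y' + 1 = G.dist z y) : (N G z y \ N G z y').Subsingleton := by
  have key : ∀ a, a ∈ N G z y \ N G z y' → G.dist a y' = G.dist z y' + 1 := by
    rintro a ⟨⟨h1, h2⟩, h3⟩
    have h4 : ¬ (G.dist a y' + 1 = G.dist z y') := fun h => h3 ⟨h1, h⟩
    have := bip hG h1 y'
    have e1 := G.dist_comm (u := a) (v := y')
    have e2 := G.dist_comm (u := z) (v := y')
    omega
  intro a ha b hb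
  exact par hG hy ha.1.1 hb.1.1 hzy ha.1.2 hb.1.2 (key a ha) (key b hb)

/-- predecessor on a geodesic -/
theorem pred (hG : MedianGraph G) {x y : V} (h : G.dist x y ≠ 0) :
    ∃ y', G.Adj y' y ∧ G.dist x y' + 1 = G.dist x y := by
  obtain ⟨p, hp⟩ := hG.1.exists_walk_length_eq_dist y x
  cases p with
  | nil => simp at h
  | @cons _ w _ hw q =>
    refine ⟨w, hw.symm, ?_⟩
    have h1 := dist_le q
    have e1 := G.dist_comm (u := x) (v := y)
    have e2 := G.dist_comm (u := x) (v := w)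
    have := bip hG hw x
    simp at hp
    omega

theorem N_card_step (hG : MedianGraph G) {z y y' : V} (hy : G.Adj y' y)
    (hzy : G.dist z y' + 1 = G.dist z y) : (N G z y).encard ≤ (N G z y').encard + 1 := by
  have h1 : (N G z y \ N G z y').encard ≤ 1 := encard_le_one_iff_subsingleton.2 (N_sub hG hy hzy)
  calc (N G z y).encard ≤ (N G z y \ N G z y').encard + (N G z y').encard :=
        encard_le_encard_sdiff_add_encard _ _
    _ ≤ 1 + (N G z y').encard := by gcongr
    _ = _ := add_comm _ _

theorem N_card (hG : MedianGraph G) (z y : V) : (N G z y).encard ≤ G.dist z y := by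
  induction hn : G.dist z y generalizing y with
  | zero =>
    have : N G z y = ∅ := by
      ext a
      simp only [N, mem_ofPred_eq, mem_empty_iff_false, iff_false, not_and]
      omega
    simp [this]
  | succ n ih =>
    obtain ⟨y', hy, h⟩ := pred hG (x := z) (y := y) (by omega)
    have := ih y' (by omega)
    refine (N_card_step hG hy h).trans ?_
    push_cast
    gcongr

def Good (G : SimpleGraph V) (z y : V) : Prop := (N G z y).encard = G.dist z y

theorem good_pred (hG : MedianGraph G) {z y y' : V} (hy : G.Adj y' y)
    (hzy : G.dist z y' + 1 = G.dist z y) (h : Good G z y) : Good G z y' := by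
  apply le_antisymm (N_card hG z y')
  have := N_card_step hG hy hzy
  rw [h, ← hzy] at this
  push_cast at this
  exact (ENat.add_le_add_iff_right (by simp)).1 this

theorem good_down (hG : MedianGraph G) {z x y : V} (h : Good G z y)
    (hx : G.dist z x + G.dist x y = G.dist z y) : Good G z x := by
  induction hn : G.dist x y generalizing y with
  | zero => rw [hG.1.dist_eq_zero_iff] at hn; rwa [hn]
  | succ n ih =>
    obtain ⟨y', hy, h'⟩ := pred hG (x := x) (y := y) (by omega)
    have t1 := hG.1.dist_triangle (u := z) (v := x) (w := y')
    have t2 := hG.1.dist_triangle (u := z) (v := y') (w := y)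
    have h1 := dist_eq_one_iff_adj.2 hy
    exact ih (y := y') (good_pred hG hy (by omega) h) (by omega) (by omega)

/-- Join of `x` and an atom `a` below `u`. -/
theorem join (hG : MedianGraph G) {z x u a : V} (hx : G.dist z x + G.dist x u = G.dist z u)
    (ha : a ∈ N G z u) (hax : a ∉ N G z x) :
    ∃ y, G.Adj x y ∧ G.dist z y = G.dist z x + 1 ∧ G.dist z y + G.dist y u = G.dist z u ∧
      G.dist a y = G.dist z x ∧ G.dist a x = G.dist z x + 1 ∧ a ∈ N G z y := by
  obtain ⟨ha1, ha2⟩ := ha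
  have hax' : ¬ (G.dist a x + 1 = G.dist z x) := fun h => hax ⟨ha1, h⟩
  have b := bip hG ha1 x
  have h1 := dist_eq_one_iff_adj.2 ha1
  have e1 := G.dist_comm (u := x) (v := a)
  have e2 := G.dist_comm (u := x) (v := z)
  obtain ⟨y, y1, y2, y3⟩ := med_ex hG u a x
  have e3 := G.dist_comm (u := u) (v := a)
  have e4 := G.dist_comm (u := x) (v := u)
  have e5 := G.dist_comm (u := y) (v := a)
  have e6 := G.dist_comm (u := y) (v := u)
  have e7 := G.dist_comm (u := y) (v := x)
  have t1 := hG.1.dist_triangle (u := z) (v := x) (w := y)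
  have t2 := hG.1.dist_triangle (u := z) (v := y) (w := u)
  refine ⟨y, dist_eq_one_iff_adj.1 (by omega), by omega, by omega, by omega, by omega, ha1, by omega⟩

theorem good_fin (hG : MedianGraph G) (z y : V) : (N G z y).Finite := by
  rw [← encard_lt_top_iff]
  exact (N_card hG z y).trans_lt (by simp)

theorem good_le (hG : MedianGraph G) {z x u : V} (h : Good G z x) (hs : N G z x ⊆ N G z u) :
    G.dist z x + G.dist x u = G.dist z u := by
  induction hn : G.dist z x generalizing x with
  | zero => rw [hG.1.dist_eq_zero_iff] at hn; rw [hn]; simp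
  | succ n ih =>
    obtain ⟨x', hx, h'⟩ := pred hG (x := z) (y := x) (by omega)
    have g' := good_pred hG hx h' h
    have hxx := dist_eq_one_iff_adj.2 hx
    have hsub : N G z x' ⊆ N G z x := N_mono hG (by omega)
    have i := ih g' (hsub.trans hs) (by omega)
    obtain ⟨a, ha, ha'⟩ : ∃ a ∈ N G z x, a ∉ N G z x' := by
      by_contra hcon
      push Not at hcon
      have heq : N G z x' = N G z x := hsub.antisymm hcon
      rw [Good, heq, h] at g'
      have : G.dist z x = G.dist z x' := by exact_mod_cast g'
      omega
    obtain ⟨y, y1, y2, y3, y4, y5, y6⟩ := join hG (u := u) (by omega) (hs ha) ha'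
    have hxy : x = y := by
      have e1 := G.dist_comm (u := x) (v := a)
      have e2 := G.dist_comm (u := y) (v := a)
      have e3 := G.dist_comm (u := x) (v := z)
      have e4 := G.dist_comm (u := y) (v := z)
      have e5 := G.dist_comm (u := x') (v := z)
      have e6 := G.dist_comm (u := x') (v := a)
      have := ha.2
      exact par hG (z := x') (y := a) (y' := z) ha.1 hx y1 (by omega) (by omega) (by omega)
        (by omega) (by omega)
    subst hxy
    omega

theorem good_exists (hG : MedianGraph G) {z v : V} (A : Finset V) (hA : (A : Set V) ⊆ N G z v) :
    ∃ x, Good G z x ∧ G.dist z x + G.dist x v = G.dist z v ∧ N G z x = A := by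
  classical
  induction A using Finset.induction_on with
  | empty =>
    have h0 : N G z z = ∅ := by
      ext a
      simp [N]
    exact ⟨z, by simp [Good, h0], by simp, by simp [h0]⟩
  | insert a A haA ih =>
    rw [Finset.coe_insert, insert_subset_iff] at hA
    obtain ⟨x, gx, hx, hxA⟩ := ih hA.2
    obtain ⟨y, y1, y2, y3, y4, y5, y6⟩ := join hG hx hA.1 (by rw [hxA]; exact_mod_cast haA)
    have hxy := dist_eq_one_iff_adj.2 y1
    have hsub : ((insert a A : Finset V) : Set V) ⊆ N G z y := by
      rw [Finset.coe_insert, insert_subset_iff, ← hxA]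
      exact ⟨y6, N_mono hG (by omega)⟩
    have hc : ((insert a A : Finset V) : Set V).encard = G.dist z y := by
      rw [Good, hxA, encard_coe_eq_coe_finsetCard] at gx
      rw [encard_coe_eq_coe_finsetCard, Finset.card_insert_of_notMem haA, y2]
      push_cast
      rw [gx]
    have heq := (Finset.finite_toSet (insert a A)).eq_of_subset_of_encard_le hsub
      (by rw [hc]; exact N_card hG z y)
    exact ⟨y, by rw [Good, ← heq, hc], y3, heq.symm⟩

theorem good_gate (hG : MedianGraph G) (z v : V) :
    ∃ g, Good G z g ∧ ∀ u, Good G z u → G.dist v u = G.dist v g + G.dist g u := by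
  obtain ⟨g, gg, hg, hN⟩ := good_exists hG (z := z) (v := v) (good_fin hG z v).toFinset (by simp)
  rw [Finite.coe_toFinset] at hN
  refine ⟨g, gg, fun u hu => ?_⟩
  obtain ⟨x, x1, x2, x3⟩ := med_ex hG z u v
  have gx := good_down hG hu x1
  have e1 := G.dist_comm (u := x) (v := z)
  have e2 := G.dist_comm (u := x) (v := u)
  have e3 := G.dist_comm (u := x) (v := v)
  have e4 := G.dist_comm (u := v) (v := z)
  have e5 := G.dist_comm (u := v) (v := u)
  have e6 := G.dist_comm (u := v) (v := g)
  have e7 := G.dist_comm (u := x) (v := g)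
  have := good_le hG (u := g) gx (by rw [hN]; exact N_mono hG (by omega))
  have t1 := hG.1.dist_triangle (u := g) (v := x) (w := u)
  have t2 := hG.1.dist_triangle (u := v) (v := g) (w := u)
  omega

theorem good_star (hG : MedianGraph G) {z u : V} (hu : Good G z u) : u ∈ gStar G z := by
  classical
  have hfin := good_fin hG z u
  have hcard : hfin.toFinset.card = G.dist z u := by
    have := hu
    rw [Good, hfin.encard_eq_coe_toFinset_card] at this
    exact_mod_cast this
  let e : Fin (G.dist z u) ≃ hfin.toFinset := (finCongr hcard.symm).trans hfin.toFinset.equivFin.symm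
  let i : Fin (G.dist z u) ↪ V := e.toEmbedding.trans (Function.Embedding.subtype _)
  have hi : ∀ A : Finset (Fin (G.dist z u)), ((A.map i : Finset V) : Set V) ⊆ N G z u := by
    intro A a ha
    simp only [Finset.coe_map, mem_image] at ha
    obtain ⟨j, -, rfl⟩ := ha
    have := (e j).2
    rw [Finite.mem_toFinset] at this
    exact this
  choose f f1 f2 f3 using fun A => good_exists hG (A.map i) (hi A)
  have fd : ∀ A, G.dist z (f A) = A.card := by
    intro A
    have := f1 A
    rw [Good, f3, encard_coe_eq_coe_finsetCard, Finset.card_map] at this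
    exact_mod_cast this.symm
  have fsub : ∀ A B, N G z (f A) ⊆ N G z (f B) ↔ A ⊆ B := by
    intro A B
    rw [f3, f3, Finset.coe_subset, Finset.map_subset_map]
  have fle : ∀ A B, A ⊆ B → A.card + G.dist (f A) (f B) = B.card := by
    intro A B h
    have := good_le hG (f1 A) ((fsub A B).2 h)
    rwa [fd, fd] at this
  have adj1 : ∀ A B, G.Adj (f A) (f B) → A.card + 1 = B.card → (symmDiff A B).card = 1 := by
    intro A B h hc
    have h1 := dist_eq_one_iff_adj.2 h
    have : A ⊆ B := (fsub A B).1 (N_mono hG (by rw [fd, fd]; omega))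
    rw [symmDiff_of_le (by exact this), Finset.card_sdiff_of_subset this]
    omega
  have adj2 : ∀ A B, (symmDiff A B).card = 1 → A ⊆ B → G.Adj (f A) (f B) := by
    intro A B h hs
    rw [symmDiff_of_le (by exact hs), Finset.card_sdiff_of_subset hs] at h
    have := fle A B hs
    exact dist_eq_one_iff_adj.1 (by omega)
  refine ⟨G.dist z u, f, ?_, ?_, ⟨∅, ?_⟩, ⟨Finset.univ, ?_⟩⟩
  · intro A B h
    exact ((fsub A B).1 (by rw [h])).antisymm ((fsub B A).1 (by rw [h]))
  · intro A B
    constructor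
    · intro h
      have b := bip hG h z
      rw [fd, fd] at b
      rcases b with b | b
      · exact adj1 A B h b.symm
      · rw [symmDiff_comm]; exact adj1 B A h.symm b.symm
    · intro h
      obtain ⟨j, hj⟩ := Finset.card_eq_one.1 h
      by_cases hjA : j ∈ A
      · refine (adj2 B A (by rwa [symmDiff_comm]) ?_).symm
        intro k hk
        by_contra hkA
        have : k ∈ symmDiff A B := Finset.mem_symmDiff.2 (Or.inr ⟨hk, hkA⟩)
        rw [hj, Finset.mem_singleton] at this
        exact hkA (this ▸ hjA)
      · refine adj2 A B h ?_
        intro k hk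
        by_contra hkB
        have : k ∈ symmDiff A B := Finset.mem_symmDiff.2 (Or.inl ⟨hk, hkB⟩)
        rw [hj, Finset.mem_singleton] at this
        exact hjA (this ▸ hk)
  · have := fd ∅
    rw [Finset.card_empty, hG.1.dist_eq_zero_iff] at this
    exact this.symm
  · have h1 := fd Finset.univ
    have h2 := f2 Finset.univ
    rw [Finset.card_univ, Fintype.card_fin] at h1
    exact hG.1.dist_eq_zero_iff.1 (by omega)

theorem cube_dist0 (hG : MedianGraph G) {d : ℕ} (f : Finset (Fin d) → V)
    (hf : Function.Injective f) (ha : ∀ A B, G.Adj (f A) (f B) ↔ (symmDiff A B).card = 1)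
    (A : Finset (Fin d)) : G.dist (f ∅) (f A) = A.card := by
  induction hn : A.card using Nat.strong_induction_on generalizing A with
  | _ n ih =>
  rcases Nat.lt_or_ge n 2 with h | h
  · interval_cases n
    · rw [Finset.card_eq_zero] at hn; simp [hn]
    · rw [dist_eq_one_iff_adj, ha]
      rwa [← Finset.bot_eq_empty, bot_symmDiff]
  · obtain ⟨i, hi, j, hj, hij⟩ := Finset.one_lt_card.1 (by omega : 1 < A.card)
    have hji : j ∈ A.erase i := Finset.mem_erase.2 ⟨hij.symm, hj⟩
    have hijm : i ∈ A.erase j := Finset.mem_erase.2 ⟨hij, hi⟩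
    have er : ∀ (B : Finset (Fin d)) k, k ∈ B → G.Adj (f (B.erase k)) (f B) := by
      intro B k hk
      rw [ha, symmDiff_of_le (by exact Finset.erase_subset _ _),
        Finset.card_sdiff_of_subset (Finset.erase_subset _ _), Finset.card_erase_of_mem hk]
      have := Finset.card_pos.2 ⟨k, hk⟩
      omega
    have c1 : (A.erase i).card = n - 1 := by rw [Finset.card_erase_of_mem hi, hn]
    have c2 : (A.erase j).card = n - 1 := by rw [Finset.card_erase_of_mem hj, hn]
    have c3 : ((A.erase i).erase j).card = n - 2 := by
      rw [Finset.card_erase_of_mem hji, c1]; omega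
    have d1 := ih _ (by omega) (A.erase i) c1
    have d2 := ih _ (by omega) (A.erase j) c2
    have d3 := ih _ (by omega) ((A.erase i).erase j) c3
    have a1 := er A i hi
    have a2 := er A j hj
    have a3 := er (A.erase i) j hji
    have a4 := er (A.erase j) i hijm
    rw [Finset.erase_right_comm] at a4
    have hne : f (A.erase i) ≠ f (A.erase j) := by
      intro h
      have := hf h
      rw [this] at hji
      simp at hji
    have hne2 : f A ≠ f ((A.erase i).erase j) := by
      intro h
      have := congrArg Finset.card (hf h)
      omega
    have b := bip hG a1 (f ∅)
    have b2 := bip hG a2 (f (A.erase i))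
    have e0 : G.dist (f (A.erase i)) (f (A.erase j)) ≠ 0 := fun h => hne (hG.1.dist_eq_zero_iff.1 h)
    rw [← dist_eq_one_iff_adj] at a1 a2 a3 a4
    by_contra hcon
    apply hne2
    have e1 := G.dist_comm (u := f A) (v := f (A.erase i))
    have e2 := G.dist_comm (u := f A) (v := f (A.erase j))
    have e3 := G.dist_comm (u := f A) (v := f ∅)
    have e4 := G.dist_comm (u := f ((A.erase i).erase j)) (v := f (A.erase i))
    have e5 := G.dist_comm (u := f ((A.erase i).erase j)) (v := f (A.erase j))
    have e6 := G.dist_comm (u := f ((A.erase i).erase j)) (v := f ∅)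
    have e7 := G.dist_comm (u := f (A.erase j)) (v := f ∅)
    apply med_unique hG (f (A.erase i)) (f (A.erase j)) (f ∅) <;> omega

theorem star_good (hG : MedianGraph G) {z u : V} (hu : u ∈ gStar G z) : Good G z u := by
  classical
  obtain ⟨d, f, hf, ha, ⟨A, rfl⟩, ⟨B, rfl⟩⟩ := hu
  have dist : ∀ A B, G.dist (f A) (f B) = (symmDiff A B).card := by
    intro A B
    have := cube_dist0 hG (fun C => f (symmDiff A C))
      (fun C D h => symmDiff_right_injective A (hf h))
      (fun C D => by
        rw [ha, symmDiff_symmDiff_symmDiff_comm, symmDiff_self, bot_symmDiff]) (symmDiff A B)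
    simp only [symmDiff_symmDiff_cancel_left] at this
    rw [← this, ← Finset.bot_eq_empty, symmDiff_bot]
  apply le_antisymm (N_card hG _ _)
  rw [dist]
  have hinj : Function.Injective (fun i : Fin d => f (symmDiff A {i})) := by
    intro i j h
    exact Finset.singleton_injective (symmDiff_right_injective A (hf h))
  rw [← encard_coe_eq_coe_finsetCard, ← hinj.encard_image]
  apply encard_le_encard
  rintro _ ⟨i, hi, rfl⟩
  rw [Finset.mem_coe] at hi
  refine ⟨(ha _ _).2 (by simp), ?_⟩
  rw [dist, dist, symmDiff_assoc, symmDiff_left_comm, symmDiff_comm, symmDiff_of_ge,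
    Finset.card_sdiff_of_subset]
  · have := Finset.card_pos.2 ⟨i, hi⟩
    simp
    omega
  · exact Finset.singleton_subset_iff.2 hi
  · exact Finset.singleton_subset_iff.2 hi

end StarGated

/-- In a median graph, the star of any vertex is gated. -/
theorem star_gated {V : Type*} (G : SimpleGraph V) (hG : MedianGraph G) (z : V) :
    Gated G (gStar G z) := by
  intro v
  obtain ⟨g, hg, h⟩ := StarGated.good_gate hG z v
  exact ⟨g, StarGated.good_star hG hg, fun u hu => h u (StarGated.star_good hG hu)⟩
end

section
/- Let H be a gated set of vertices of a median graph G. Then for every x ∈ H, the total boundary ∂*F(x) of the fiber F(x) induces an isometric subgraph of G: any two vertices u, v ∈ ∂*F(x) can be joined inside ∂*F(x) by a path of length d_G(u,v). -/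
open SimpleGraph Set

/-- The fiber of `x` is starshaped at `x`. -/
theorem fiber_star {V : Type*} (G : SimpleGraph V) (hc : G.Connected) (H : Set V) (x u w : V)
    (hu : u ∈ fiber G H x) (hw : w ∈ gInterval G u x) : w ∈ fiber G H x := by
  refine ⟨hu.1, fun h hh => ?_⟩
  have h1 := hu.2 h hh
  have h2 : G.dist u w + G.dist w x = G.dist u x := hw
  have h3 := hc.dist_triangle (u := u) (v := w) (w := h)
  have h4 := hc.dist_triangle (u := w) (v := x) (w := h)
  omega

/-- Each boundary `∂_y F(x)` is starshaped at `x`. -/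
theorem bdry_star {V : Type*} (G : SimpleGraph V) (hG : MedianGraph G) (H : Set V) (x y u w : V)
    (hxy : G.Adj x y)
    (hu : u ∈ bdry G H x y) (hw : w ∈ gInterval G u x) : w ∈ bdry G H x y := by
  obtain ⟨hc, hm⟩ := hG
  obtain ⟨huF, u', hu'F, huu'⟩ := hu
  have hwF := fiber_star G hc H x u w huF hw
  refine ⟨hwF, ?_⟩
  have h2 : G.dist u w + G.dist w x = G.dist u x := hw
  have e1 : G.dist x y = 1 := SimpleGraph.dist_eq_one_iff_adj.2 hxy
  have e1' : G.dist y x = 1 := SimpleGraph.dist_eq_one_iff_adj.2 hxy.symm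
  have e2 : G.dist u u' = 1 := SimpleGraph.dist_eq_one_iff_adj.2 huu'
  have a1 := huF.2 y hu'F.1
  have a2 := hu'F.2 x huF.1
  have a3 := hwF.2 y hu'F.1
  obtain ⟨m, ⟨m1, m2, m3⟩, -⟩ := hm w u' y
  have m1 : G.dist w m + G.dist m u' = G.dist w u' := m1
  have m2' : G.dist u' m + G.dist m y = G.dist u' y := m2
  have m3 : G.dist y m + G.dist m w = G.dist y w := m3
  have t1 := hc.dist_triangle (u := w) (v := u) (w := u')
  have t2 := hc.dist_triangle (u := u') (v := w) (w := x)
  have t3 := hc.dist_triangle (u := u') (v := u) (w := x)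
  have t4 := hc.dist_triangle (u := u) (v := u') (w := y)
  have c1 := G.dist_comm (u := w) (v := u)
  have c2 := G.dist_comm (u := w) (v := u')
  have c3 := G.dist_comm (u := u) (v := u')
  have c4 := G.dist_comm (u := m) (v := w)
  have c5 := G.dist_comm (u := m) (v := u')
  have c6 := G.dist_comm (u := m) (v := y)
  have c7 := G.dist_comm (u := w) (v := y)
  refine ⟨m, fiber_star G hc H y u' m hu'F m2, SimpleGraph.dist_eq_one_iff_adj.1 ?_⟩
  omega

theorem geodesic_support {V : Type*} (G : SimpleGraph V) (u v w : V) (p : G.Walk u v)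
    (hp : p.length = G.dist u v) (hc : G.Connected) (hw : w ∈ p.support) :
    w ∈ gInterval G u v := by
  classical
  show G.dist u w + G.dist w v = G.dist u v
  have h1 := congrArg SimpleGraph.Walk.length (p.take_spec hw)
  rw [SimpleGraph.Walk.length_append] at h1
  have h2 := SimpleGraph.dist_le (p.takeUntil w hw)
  have h3 := SimpleGraph.dist_le (p.dropUntil w hw)
  have h4 := hc.dist_triangle (u := u) (v := w) (w := v)
  omega

/-- In a median graph, the total boundary of a fiber of a gated set induces an
isometric subgraph: any two of its vertices are joined inside of it by a path of
length `d_G(u,v)`. -/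
theorem total_boundary_isometric {V : Type*} (G : SimpleGraph V)
    (hG : MedianGraph G) (H : Set V) (hH : Gated G H) (x : V) (hx : x ∈ H)
    (u v : V) (hu : u ∈ totalBdry G H x) (hv : v ∈ totalBdry G H x) :
    ∃ p : G.Walk u v, p.length = G.dist u v ∧
      ∀ w ∈ p.support, w ∈ totalBdry G H x := by
  obtain ⟨hc, hm⟩ := hG
  simp only [totalBdry, Set.mem_iUnion] at hu hv ⊢
  obtain ⟨y, hy, hu⟩ := hu
  obtain ⟨z, hz, hv⟩ := hv
  obtain ⟨m, ⟨m1, m2, m3⟩, -⟩ := hm u v x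
  have m1 : G.dist u m + G.dist m v = G.dist u v := m1
  have m2 : G.dist v m + G.dist m x = G.dist v x := m2
  have m3 : G.dist x m + G.dist m u = G.dist x u := m3
  have c1 := G.dist_comm (u := m) (v := v)
  have c2 := G.dist_comm (u := m) (v := u)
  have c3 := G.dist_comm (u := m) (v := x)
  have c4 := G.dist_comm (u := x) (v := u)
  obtain ⟨p, hp⟩ := hc.exists_walk_length_eq_dist u m
  obtain ⟨q, hq⟩ := hc.exists_walk_length_eq_dist m v
  refine ⟨p.append q, by rw [SimpleGraph.Walk.length_append]; omega, fun w hw => ?_⟩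
  have t1 := hc.dist_triangle (u := w) (v := m) (w := x)
  rcases (SimpleGraph.Walk.mem_support_append_iff p q).1 hw with hw | hw
  · refine ⟨y, hy, bdry_star G ⟨hc, hm⟩ H x y u w hy.2 hu ?_⟩
    have h1 : G.dist u w + G.dist w m = G.dist u m := geodesic_support G u m w p hp hc hw
    have t2 := hc.dist_triangle (u := u) (v := w) (w := x)
    show G.dist u w + G.dist w x = G.dist u x
    omega
  · refine ⟨z, hz, bdry_star G ⟨hc, hm⟩ H x z v w hz.2 hv ?_⟩
    have h1 : G.dist m w + G.dist w v = G.dist m v := geodesic_support G m v w q hq hc hw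
    have t2 := hc.dist_triangle (u := v) (v := w) (w := x)
    have c5 := G.dist_comm (u := w) (v := v)
    have c6 := G.dist_comm (u := w) (v := m)
    show G.dist v w + G.dist w x = G.dist v x
    omega
end
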